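/- arXiv:1804.00990 — 4 statements merged into one kernel-verified Lean document; each statement's English description precedes it below -/
import Mathlib

section
/- If x is an admissible monomial of degree 25 in P_5 whose class [x] lies in the kernel of Kameko's homomorphism (S̃q^0_*)_{(5,10)} : (QP_5)_{25} → (QP_5)_{10}, then ω(x) = (3,3,2,1) or ω(x) = (3,3,4). -/
open MvPolynomial

noncomputable section

/-- `P n` is the polynomial algebra `F_2[x_1, …, x_n]`, with `x_{k+1}` corresponding to
the variable indexed by `k : Fin n`. -/
abbrev P (n : ℕ) : Type := MvPolynomial (Fin n) (ZMod 2)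

/-- The total Steenrod square, the ring homomorphism determined by `x_i ↦ x_i + x_i^2`. -/
def sqTot (n : ℕ) : P n →ₐ[ZMod 2] P n := bind₁ fun i => X i + X i ^ 2

/-- The Steenrod square `Sq^k`: on a homogeneous polynomial of degree `d` it is the
homogeneous component of degree `d + k` of the total square, extended additively. -/
def SqK (n k : ℕ) (f : P n) : P n :=
  ∑ d ∈ Finset.range (f.totalDegree + 1),
    homogeneousComponent (d + k) (sqTot n (homogeneousComponent d f))

/-- `A^+ P_n = Σ_{j ≥ 1} Sq^j(P_n)`, the submodule of hit polynomials. -/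
def hitS (n : ℕ) : Submodule (ZMod 2) (P n) :=
  Submodule.span (ZMod 2) {g | ∃ j, 1 ≤ j ∧ ∃ h, g = SqK n j h}

/-- `A_s^+ P_n = Σ_{1 ≤ j < 2^s} Sq^j(P_n)`. -/
def AplusS (n s : ℕ) : Submodule (ZMod 2) (P n) :=
  Submodule.span (ZMod 2) {g | ∃ j, 1 ≤ j ∧ j < 2 ^ s ∧ ∃ h, g = SqK n j h}

/-- Degree of a monomial given by its exponent vector. -/
def mdeg {n : ℕ} (a : Fin n →₀ ℕ) : ℕ := ∑ j, a j

/-- The weight vector of a monomial, zero-based: `wt a i = ω_{i+1}(x) = Σ_j α_i(a_j)`. -/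
def wt {n : ℕ} (a : Fin n →₀ ℕ) (i : ℕ) : ℕ := ∑ j, a j / 2 ^ i % 2

/-- Left-lexicographic strict order on weight vectors. -/
def lexLt (w w' : ℕ → ℕ) : Prop := ∃ i, (∀ j, j < i → w j = w' j) ∧ w i < w' i

def lexLe (w w' : ℕ → ℕ) : Prop := w = w' ∨ lexLt w w'

/-- `P_n^-(ω)`: span of monomials of degree `D = deg ω` with weight vector `< ω`. -/
def PnLt (n D : ℕ) (w : ℕ → ℕ) : Submodule (ZMod 2) (P n) :=
  Submodule.span (ZMod 2)
    {p | ∃ a : Fin n →₀ ℕ, mdeg a = D ∧ lexLt (wt a) w ∧ p = monomial a 1}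

/-- `P_n(ω)`: span of monomials of degree `D = deg ω` with weight vector `≤ ω`. -/
def PnLe (n D : ℕ) (w : ℕ → ℕ) : Submodule (ZMod 2) (P n) :=
  Submodule.span (ZMod 2)
    {p | ∃ a : Fin n →₀ ℕ, mdeg a = D ∧ lexLe (wt a) w ∧ p = monomial a 1}

/-- The order on monomials (of a common degree): first by weight vector, then by
exponent vector, both left-lexicographically. -/
def monLt {n : ℕ} (a b : Fin n →₀ ℕ) : Prop :=
  lexLt (wt a) (wt b) ∨
    (wt a = wt b ∧ ∃ j : Fin n, (∀ k, k < j → a k = b k) ∧ a j < b j)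

/-- A monomial is inadmissible if it is congruent, modulo hit elements, to a sum of
strictly smaller monomials of the same degree. -/
def Inadmissible {n : ℕ} (a : Fin n →₀ ℕ) : Prop :=
  ∃ S : Finset (Fin n →₀ ℕ), (∀ b ∈ S, mdeg b = mdeg a ∧ monLt b a) ∧
    ((monomial a 1 : P n) + ∑ b ∈ S, monomial b 1) ∈ hitS n

def Admissible {n : ℕ} (a : Fin n →₀ ℕ) : Prop := ¬ Inadmissible a

/-- Strict inadmissibility: with `s` the top of the weight vector, the monomial is
congruent to a sum of smaller monomials modulo `A_s^+ P_n`. -/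
def StrictlyInadmissible {n : ℕ} (a : Fin n →₀ ℕ) : Prop :=
  ∃ s : ℕ, 1 ≤ s ∧ wt a (s - 1) ≠ 0 ∧ (∀ i, s ≤ i → wt a i = 0) ∧
    ∃ S : Finset (Fin n →₀ ℕ), (∀ b ∈ S, mdeg b = mdeg a ∧ monLt b a) ∧
      ((monomial a 1 : P n) + ∑ b ∈ S, monomial b 1) ∈ AplusS n s

/-- Exponent vector from a tuple of exponents. -/
def ev {n : ℕ} (v : Fin n → ℕ) : Fin n →₀ ℕ := Finsupp.equivFunOnFinite.symm v

/-- `ν_k(x)`, the exponent of the (1-based) variable `x_k` in a monomial. -/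
def nuE {m : ℕ} (b : Fin m →₀ ℕ) (k : ℕ) : ℕ := if h : k - 1 < m then b ⟨k - 1, h⟩ else 0

/-- `u`-compatibility of a monomial of `P_{n-1}` with a pair `(i; I)` (only `I` matters);
by convention every monomial is `1`-compatible with `(i; ∅)`. -/
def uCompat {m : ℕ} (I : List ℕ) (u : ℕ) (b : Fin m →₀ ℕ) : Prop :=
  if I = [] then u = 1 else
    1 ≤ u ∧ u ≤ I.length ∧
    (∀ t, 1 ≤ t → t < u → nuE b (I.getD (t - 1) 0 - 1) = 2 ^ I.length - 1) ∧
    2 ^ I.length - 1 < nuE b (I.getD (u - 1) 0 - 1) ∧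
    (∀ t, 1 ≤ t → t ≤ u → Nat.testBit (nuE b (I.getD (u - 1) 0 - 1)) (I.length - t) = true) ∧
    (∀ t, u < t → t ≤ I.length → Nat.testBit (nuE b (I.getD (t - 1) 0 - 1)) (I.length - t) = true)

/-- The exponent vector of `x_{(I,u)} = x_{i_u}^{2^{r-1}+⋯+2^{r-u}} Π_{u<t≤r} x_{i_t}^{2^{r-t}}`. -/
def xIuExp (n : ℕ) (I : List ℕ) (u : ℕ) : Fin n → ℕ := fun k =>
  (if I.getD (u - 1) 0 = (k : ℕ) + 1 then 2 ^ I.length - 2 ^ (I.length - u) else 0) +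
  ∑ t ∈ Finset.Icc (u + 1) I.length,
    if I.getD (t - 1) 0 = (k : ℕ) + 1 then 2 ^ (I.length - t) else 0

/-- The variable substitution underlying `f_i : P_{n-1} → P_n` (`x_j ↦ x_j` for `j < i`,
`x_j ↦ x_{j+1}` for `j ≥ i`, in 1-based labels). -/
def fIdx (n i : ℕ) (j : Fin (n - 1)) : Fin n :=
  if (j : ℕ) + 1 < i then ⟨j, by have := j.isLt; omega⟩
  else ⟨(j : ℕ) + 1, by have := j.isLt; omega⟩

open Classical in
/-- `φ_{(i;I)}` evaluated on the monomial of `P_{n-1}` with exponent vector `b`: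
`(x_i^{2^r - 1} f_i(x)) / x_{(I,u)}` if `x` is `u`-compatible with `(i;I)` for some `u`,
and `0` otherwise.  Here `i` and the entries of `I` are 1-based variable labels. -/
def phiMon (n i : ℕ) (I : List ℕ) (b : Fin (n - 1) →₀ ℕ) : P n :=
  if h : ∃ u, uCompat I u b then
    monomial (ev fun k : Fin n =>
      (if (k : ℕ) + 1 = i then 2 ^ I.length - 1 else 0) +
        Finsupp.mapDomain (fIdx n i) b k - xIuExp n I (Classical.choose h) k) 1
  else 0

/-- Exponent vector of `X^e = (x_1 ⋯ x_m)^e` in `P_m`. -/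
def Xexp (m e : ℕ) : Fin m →₀ ℕ := ev fun _ => e

/-- `X_u^e = (Π_{j ≠ u} x_j)^e` in `P_n` (`u` 1-based). -/
def XjMon (n u e : ℕ) : P n := monomial (ev fun k : Fin n => if (k : ℕ) + 1 = u then 0 else e) 1

/-- `x_u^e` in `P_n` (`u` 1-based). -/
def xvMon (n u e : ℕ) : P n := monomial (ev fun k : Fin n => if (k : ℕ) + 1 = u then e else 0) 1

/-- The weight vector `((n-1)^{(d)}, 1)` (zero-based indexing). -/
def wSpike (n d : ℕ) : ℕ → ℕ := fun i => if i < d then n - 1 else if i = d then 1 else 0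

/-- Kameko's map `ψ : P_5 → P_5`, `x_1x_2x_3x_4x_5 · y^2 ↦ y` on monomials, `0` otherwise. -/
def psi : P 5 →ₗ[ZMod 2] P 5 :=
  (basisMonomials (Fin 5) (ZMod 2)).constr (ZMod 2) fun a =>
    if ∀ j, Odd (a j) then monomial (Finsupp.mapRange (· / 2) (Nat.zero_div 2) a) 1 else 0

/-- The Σ₅-invariant subspace of a subspace `V` of `QP_5 = P_5 / A^+P_5`: classes in `V`
having a representative `f` with `[σ · f] = [f]` for all permutations `σ` of the variables. -/
def invSub (V : Submodule (ZMod 2) (P 5 ⧸ hitS 5)) : Submodule (ZMod 2) (P 5 ⧸ hitS 5) where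
  carrier := {q | q ∈ V ∧ ∃ f : P 5, (hitS 5).mkQ f = q ∧
      ∀ σ : Equiv.Perm (Fin 5), (hitS 5).mkQ (rename (⇑σ) f) = q}
  add_mem' := by
    rintro a b ⟨haV, f, hf, hfa⟩ ⟨hbV, g, hg, hgb⟩
    refine ⟨V.add_mem haV hbV, f + g, ?_, fun σ => ?_⟩
    · simp [map_add, hf, hg]
    · simp [map_add, hfa σ, hgb σ]
  zero_mem' := ⟨V.zero_mem, 0, by simp, fun σ => by simp⟩
  smul_mem' := by
    rintro c a ⟨haV, f, hf, hfa⟩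
    refine ⟨V.smul_mem c haV, c • f, ?_, fun σ => ?_⟩
    · simp [map_smul, hf]
    · simp [map_smul, hfa σ]

/-- The maps `ρ_1, …, ρ_5` generating the action of `GL_5` on `P_5`:
`ρ_i` (for `1 ≤ i ≤ 4`) swaps `x_i, x_{i+1}`; `ρ_5` sends `x_1 ↦ x_1 + x_2`. -/
def rho5 (i : ℕ) : P 5 → P 5 := fun f =>
  if i = 1 then rename (⇑(Equiv.swap (0 : Fin 5) 1)) f
  else if i = 2 then rename (⇑(Equiv.swap (1 : Fin 5) 2)) f
  else if i = 3 then rename (⇑(Equiv.swap (2 : Fin 5) 3)) f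
  else if i = 4 then rename (⇑(Equiv.swap (3 : Fin 5) 4)) f
  else if i = 5 then MvPolynomial.aeval (R := ZMod 2)
    (fun j : Fin 5 => if j = 0 then X 0 + X 1 else X j) f
  else f

/-- The action of an invertible matrix on `P_5` by linear substitution of the variables. -/
def glAct (g : Matrix (Fin 5) (Fin 5) (ZMod 2)) (f : P 5) : P 5 :=
  MvPolynomial.aeval (R := ZMod 2) (fun i : Fin 5 => ∑ j : Fin 5, g i j • X j) f

/-- The weight vector `(3,3,4)` (zero-based indexing). -/
def w334 : ℕ → ℕ := fun i => if i = 0 then 3 else if i = 1 then 3 else if i = 2 then 4 else 0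

/-- The weight vector `(3,3,2,1)` (zero-based indexing). -/
def w3321 : ℕ → ℕ := fun i =>
  if i = 0 then 3 else if i = 1 then 3 else if i = 2 then 2 else if i = 3 then 1 else 0

section Helpers

open Finsupp

variable {n : ℕ}

abbrev RS (n : ℕ) (s : Set (Fin n →₀ ℕ)) : Submodule (ZMod 2) (P n) :=
  restrictSupport (ZMod 2) s

lemma RS_map {s : Set (Fin n →₀ ℕ)} {N : Submodule (ZMod 2) (P n)} (φ : P n →ₗ[ZMod 2] P n)
    (h : ∀ b ∈ s, φ (monomial b 1) ∈ N) {p : P n} (hp : p ∈ RS n s) : φ p ∈ N := by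
  have : RS n s ≤ N.comap φ := by
    rw [RS, restrictSupport_eq_span, Submodule.span_le]
    rintro _ ⟨b, hb, rfl⟩
    exact h b hb
  exact this hp

lemma mem_univ_RS (p : P n) : p ∈ RS n Set.univ := by
  rw [RS, restrictSupport_univ]; trivial

lemma RS_mul {s t : Set (Fin n →₀ ℕ)} (c : Fin n →₀ ℕ) (h : ∀ b ∈ s, c + b ∈ t) {p : P n}
    (hp : p ∈ RS n s) : monomial c 1 * p ∈ RS n t := by
  refine RS_map (LinearMap.mulLeft (ZMod 2) (monomial c (1 : ZMod 2))) (fun b hb => ?_) hp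
  simp only [LinearMap.mulLeft_apply, monomial_mul, mul_one]
  exact (monomial_mem_restrictSupport _).2 (Or.inl (h b hb))

lemma RS_mono {s t : Set (Fin n →₀ ℕ)} (h : ∀ b ∈ s, b ∈ t) {p : P n}
    (hp : p ∈ RS n s) : p ∈ RS n t := restrictSupport_mono (R := ZMod 2) h hp

lemma RS_mon {s : Set (Fin n →₀ ℕ)} {b : Fin n →₀ ℕ} (h : b ∈ s) :
    (monomial b 1 : P n) ∈ RS n s := (monomial_mem_restrictSupport _).2 (Or.inl h)

lemma ind_X {M : (Fin n →₀ ℕ) → Prop} (h0 : M 0) (hs : ∀ c i, M c → M (c + single i 1))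
    (c : Fin n →₀ ℕ) : M c := by
  induction hd : c.degree generalizing c with
  | zero =>
    rw [Finsupp.degree_eq_zero_iff] at hd
    exact hd ▸ h0
  | succ d ih =>
    have : c ≠ 0 := by rintro rfl; simp at hd
    obtain ⟨i, hi⟩ := Finsupp.ne_iff.1 this
    have h1 : single i 1 ≤ c := by
      rw [Finsupp.single_le_iff]
      simp at hi; omega
    have h2 : c - single i 1 + single i 1 = c := tsub_add_cancel_of_le h1
    rw [← h2]
    apply hs
    apply ih
    have := congrArg Finsupp.degree h2
    simp only [map_add, Finsupp.degree_single] at this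
    omega

lemma hc_mon (d : ℕ) (b : Fin n →₀ ℕ) :
    homogeneousComponent d (monomial b 1 : P n) = if b.degree = d then monomial b 1 else 0 := by
  have := homogeneousComponent_of_mem (m := d)
    (isHomogeneous_monomial (1 : ZMod 2) (rfl : b.degree = b.degree))
  rw [this]
  simp [eq_comm]

lemma RS_hc {s : Set (Fin n →₀ ℕ)} (d : ℕ) {p : P n} (hp : p ∈ RS n s) :
    homogeneousComponent d p ∈ RS n {b | b ∈ s ∧ b.degree = d} := by
  refine RS_map (homogeneousComponent d) (fun b hb => ?_) hp
  rw [hc_mon]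
  split_ifs with h
  · exact RS_mon ⟨hb, h⟩
  · exact zero_mem _

lemma RS_empty {s : Set (Fin n →₀ ℕ)} (hs : ∀ b, b ∉ s) {p : P n} (hp : p ∈ RS n s) : p = 0 := by
  have := (mem_restrictSupport_iff _).1 hp
  rw [← MvPolynomial.support_eq_empty]
  ext b
  simp only [Finset.notMem_empty, iff_false]
  intro hb
  exact hs b (this hb)

lemma sqTot_X (i : Fin n) : sqTot n (X i) = X i + X i ^ 2 := by simp [sqTot]

lemma mon_succ (c : Fin n →₀ ℕ) (i : Fin n) :
    (monomial (c + single i 1) 1 : P n) = X i * monomial c 1 := by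
  rw [add_comm, MvPolynomial.X, monomial_mul, one_mul]

lemma X_sq (i : Fin n) : (X i ^ 2 : P n) = monomial (single i 2) 1 := by
  rw [X_pow_eq_monomial]

lemma hit_hc {h : P n} {d e : ℕ} (hh : h.IsHomogeneous d) (hde : d < e) :
    homogeneousComponent e (sqTot n h) ∈ hitS n := by
  by_cases h0 : h = 0
  · simp [h0]
  refine Submodule.subset_span ⟨e - d, by omega, h, ?_⟩
  have htd := hh.totalDegree h0
  rw [SqK, htd, Finset.sum_eq_single d]
  · rw [homogeneousComponent_eq_self hh]
    congr 2
    omega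
  · intro b _ hb
    rw [homogeneousComponent_of_mem hh, if_neg hb]
    simp
  · intro hd; simp at hd

lemma top_mon (c : Fin n →₀ ℕ) : sqTot n (monomial c 1) - monomial (2 • c) 1 ∈
    RS n {b | c.degree ≤ b.degree ∧ b.degree < 2 * c.degree} := by
  induction c using ind_X with
  | h0 =>
    have : (monomial (0 : Fin n →₀ ℕ) (1 : ZMod 2)) = 1 := rfl
    simp [this]
  | hs c i ih =>
    set r := sqTot n (monomial c 1) - monomial (2 • c) 1 with hr
    have e1 : sqTot n (monomial (c + single i 1) 1) - monomial (2 • (c + single i 1)) 1 =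
        monomial (single i 1 + 2 • c) 1 + monomial (single i 1) 1 * r +
          monomial (single i 2) 1 * r := by
      have h2 : (monomial (2 • (c + single i 1)) 1 : P n) = X i ^ 2 * monomial (2 • c) 1 := by
        rw [X_sq, monomial_mul, mul_one]
        congr 1
        simp [smul_add, add_comm]
      have h3 : (monomial (single i 1 + 2 • c) 1 : P n) = X i * monomial (2 • c) 1 := by
        rw [MvPolynomial.X, monomial_mul, one_mul]
      rw [mon_succ, map_mul, sqTot_X, h2, h3, ← X_sq]
      change _ = _ + X i * r + _
      rw [hr]
      ring
    rw [e1]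
    refine add_mem (add_mem (RS_mon ?_) (RS_mul _ ?_ ih)) (RS_mul _ ?_ ih)
    · simp only [Set.mem_ofPred_eq, map_add, map_nsmul, Finsupp.degree_single, smul_eq_mul]
      omega
    all_goals
      intro b hb
      simp only [Set.mem_ofPred_eq, map_add, Finsupp.degree_single] at hb ⊢
      omega

lemma sq_mon_hit (c : Fin n →₀ ℕ) (hc : 0 < c.degree) :
    (monomial (2 • c) 1 : P n) ∈ hitS n := by
  have h1 := hit_hc (n := n) (e := 2 * c.degree)
    (isHomogeneous_monomial (1 : ZMod 2) (rfl : c.degree = c.degree)) (by omega)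
  have h2 := RS_empty (fun b hb => by
    simp only [Set.mem_ofPred_eq] at hb; omega) (RS_hc (2 * c.degree) (top_mon c))
  rw [map_sub, sub_eq_zero, hc_mon, if_pos (by simp)] at h2
  rwa [← h2]

lemma low_mon (c : Fin n →₀ ℕ) : sqTot n (monomial c 1) ∈ RS n {b | c.degree ≤ b.degree} := by
  have h := RS_mono (t := {b | c.degree ≤ b.degree}) (fun b hb => hb.1) (top_mon c)
  have h2 : (monomial (2 • c) 1 : P n) ∈ RS n {b | c.degree ≤ b.degree} :=
    RS_mon (by simp; omega)
  simpa using add_mem h h2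

lemma sq_one (c : Fin n →₀ ℕ) : sqTot n (monomial c 1) - monomial c 1 -
    ∑ i, (c i : ZMod 2) • monomial (c + single i 1) 1 ∈ RS n {b | c.degree + 2 ≤ b.degree} := by
  induction c using ind_X with
  | h0 =>
    have : (monomial (0 : Fin n →₀ ℕ) (1 : ZMod 2)) = 1 := rfl
    simp [this]
  | hs c k ih =>
    set T : P n := ∑ i, (c i : ZMod 2) • monomial (c + single i 1) 1 with hT
    set r := sqTot n (monomial c 1) - monomial c 1 - T with hr
    have hT' : T ∈ RS n {b | c.degree + 1 ≤ b.degree} :=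
      sum_mem fun i _ => Submodule.smul_mem _ _ (RS_mon (by simp))
    have e0 : ∑ i, (((c + single k 1 : Fin n →₀ ℕ) i : ℕ) : ZMod 2) • (monomial (c + single k 1 + single i 1) 1 : P n)
        = X k * T + X k ^ 2 * monomial c 1 := by
      have : ∀ i, (((c + single k 1 : Fin n →₀ ℕ) i : ℕ) : ZMod 2) •
          (monomial (c + single k 1 + single i 1) 1 : P n) =
          X k * ((c i : ZMod 2) • monomial (c + single i 1) 1) +
          if k = i then X k ^ 2 * monomial c 1 else 0 := by
        intro i
        have : c + single k 1 + single i 1 = c + single i 1 + single k 1 := by abel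
        rw [this, mon_succ (c + single i 1) k, mon_succ c i]
        simp only [Finsupp.add_apply, Nat.cast_add, add_smul, mul_smul_comm]
        congr 1
        by_cases h : k = i
        · subst h
          simp only [Finsupp.single_eq_same, Nat.cast_one, one_smul, if_true]
          ring
        · simp [Finsupp.single_apply, h]
      rw [Finset.sum_congr rfl (fun i _ => this i), Finset.sum_add_distrib, ← Finset.mul_sum]
      simp [hT]
    have e1 : sqTot n (monomial (c + single k 1) 1) - monomial (c + single k 1) 1 -
        (X k * T + X k ^ 2 * monomial c 1) =
        monomial (single k 2) 1 * T + monomial (single k 1) 1 * r +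
          monomial (single k 2) 1 * r := by
      rw [mon_succ, map_mul, sqTot_X, ← X_sq]
      change _ = _ + X k * r + _
      rw [hr]
      ring
    rw [e0, e1]
    refine add_mem (add_mem (RS_mul _ ?_ hT') (RS_mul _ ?_ ih)) (RS_mul _ ?_ ih)
    all_goals
      intro b hb
      simp only [Set.mem_ofPred_eq, map_add, Finsupp.degree_single] at hb ⊢
      omega

lemma sq_one_hit (c : Fin n →₀ ℕ) :
    ∑ i, (c i : ZMod 2) • (monomial (c + single i 1) 1 : P n) ∈ hitS n := by
  have h1 := hit_hc (n := n) (e := c.degree + 1)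
    (isHomogeneous_monomial (1 : ZMod 2) (rfl : c.degree = c.degree)) (by omega)
  have h2 := RS_empty (fun b hb => by
    simp only [Set.mem_ofPred_eq] at hb; omega) (RS_hc (c.degree + 1) (sq_one c))
  rw [map_sub, map_sub, hc_mon, if_neg (by omega), sub_zero, sub_eq_zero] at h2
  rw [h2, map_sum] at h1
  convert h1 using 2 with i
  rw [map_smul, hc_mon, if_pos (by simp)]

/-- `x_i y^2` is hit -/
lemma one_hit (i : Fin n) (c : Fin n →₀ ℕ) (S : ℕ) (h1 : ∀ s < S, 2 ^ s < c.degree + 1)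
    (h2 : c.degree + 1 < 2 ^ S) : (monomial (single i 1 + 2 • c) 1 : P n) ∈ hitS n := by
  have hF : ∀ S : ℕ, sqTot n (∑ s ∈ Finset.range S, X i ^ (2 ^ s)) = X i - X i ^ (2 ^ S) := by
    intro S
    induction S with
    | zero => simp
    | succ S ih =>
      rw [Finset.sum_range_succ, map_add, ih, map_pow, sqTot_X, add_pow_char_pow,
        ← pow_mul, ← pow_succ']
      rw [CharTwo.sub_eq_add (X i) (X i ^ 2 ^ (S + 1))]; ring
  have e1 : ∑ s ∈ Finset.range S, sqTot n (monomial (single i (2 ^ s) + c) 1) =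
      X i * sqTot n (monomial c 1) - X i ^ (2 ^ S) * sqTot n (monomial c 1) := by
    rw [← sub_mul, ← hF S, ← map_mul, Finset.sum_mul, map_sum]
    refine Finset.sum_congr rfl fun s _ => ?_
    rw [X_pow_eq_monomial, monomial_mul, one_mul]
  have hl : homogeneousComponent (1 + 2 * c.degree)
      (∑ s ∈ Finset.range S, sqTot n (monomial (single i (2 ^ s) + c) 1)) ∈ hitS n := by
    rw [map_sum]
    refine sum_mem fun s hs => hit_hc (isHomogeneous_monomial _ rfl) ?_
    have := h1 s (Finset.mem_range.1 hs)
    simp only [map_add, Finsupp.degree_single]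
    omega
  have hz : homogeneousComponent (1 + 2 * c.degree)
      (X i ^ (2 ^ S) * sqTot n (monomial c 1)) = 0 := by
    have := RS_mul (t := {b | 2 ^ S + c.degree ≤ b.degree}) (single i (2 ^ S)) (fun b hb => by
      simp only [Set.mem_ofPred_eq, map_add, Finsupp.degree_single] at hb ⊢
      omega) (low_mon c)
    rw [← X_pow_eq_monomial] at this
    exact RS_empty (fun b hb => by
      simp only [Set.mem_ofPred_eq] at hb; omega) (RS_hc _ this)
  have hx : homogeneousComponent (1 + 2 * c.degree)
      (X i * sqTot n (monomial c 1)) = monomial (single i 1 + 2 • c) 1 := by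
    have := RS_mul (t := {b | b.degree < 1 + 2 * c.degree}) (single i 1) (fun b hb => by
      simp only [Set.mem_ofPred_eq, map_add, Finsupp.degree_single] at hb ⊢
      omega) (top_mon c)
    have := RS_empty (fun b hb => by
      simp only [Set.mem_ofPred_eq] at hb; omega) (RS_hc (1 + 2 * c.degree) this)
    rw [mul_sub, map_sub, sub_eq_zero, monomial_mul, one_mul, hc_mon, if_pos (by simp)] at this
    exact this
  rw [e1, map_sub, hz, hx, sub_zero] at hl
  exact hl

def Lower (a : Fin n →₀ ℕ) : Set (Fin n →₀ ℕ) := {b | mdeg b = mdeg a ∧ monLt b a}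

lemma inadm_of {a : Fin n →₀ ℕ} (h : (monomial a 1 : P n) ∈ hitS n ⊔ RS n (Lower a)) :
    Inadmissible a := by
  obtain ⟨y, hy, z, hz, hyz⟩ := Submodule.mem_sup.1 h
  refine ⟨z.support, fun b hb => (mem_restrictSupport_iff _).1 hz hb, ?_⟩
  have : ∑ b ∈ z.support, (monomial b 1 : P n) = z := by
    conv_rhs => rw [z.as_sum]
    refine Finset.sum_congr rfl fun b hb => ?_
    congr 1
    have h1 : ∀ t : ZMod 2, t ≠ 0 → 1 = t := by decide
    exact h1 _ (MvPolynomial.mem_support_iff.1 hb)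
  rw [this, ← hyz, add_assoc, CharTwo.add_self_eq_zero, add_zero]
  exact hy

lemma inadm_of_hit {a : Fin n →₀ ℕ} (h : (monomial a 1 : P n) ∈ hitS n) :
    Inadmissible a := inadm_of (Submodule.mem_sup_left h)

lemma mdeg_eq (a : Fin n →₀ ℕ) : mdeg a = a.degree := by
  rw [Finsupp.degree_eq_sum, mdeg]

def indI (I : Finset (Fin n)) : Fin n →₀ ℕ := ∑ i ∈ I, single i 1

lemma indI_apply (I : Finset (Fin n)) (j : Fin n) : indI I j = if j ∈ I then 1 else 0 := by
  rw [indI, Finsupp.finsetSum_apply]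
  simp [Finsupp.single_apply]

lemma deg_indI (I : Finset (Fin n)) : (indI I).degree = I.card := by
  rw [indI, map_sum]; simp

lemma wt0_indI (I : Finset (Fin n)) : wt (indI I) 0 = I.card := by
  rw [← deg_indI, Finsupp.degree_eq_sum, wt]
  refine Finset.sum_congr rfl fun j _ => ?_
  rw [indI_apply]
  split_ifs <;> rfl

lemma mon_indI (I : Finset (Fin n)) : (monomial (indI I) 1 : P n) = ∏ i ∈ I, X i := by
  rw [indI, monomial_sum_one]; rfl

lemma wt0_add_two (b c : Fin n →₀ ℕ) : wt (b + 2 • c) 0 = wt b 0 := by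
  refine Finset.sum_congr rfl fun j _ => ?_
  simp [Nat.add_mul_mod_self_left]

lemma wt0_add_single (b : Fin n →₀ ℕ) (k : Fin n) : wt (b + single k 1) 0 ≤ wt b 0 + 1 := by
  have : wt b 0 + 1 = ∑ j, (b j / 2 ^ 0 % 2 + if k = j then 1 else 0) := by
    rw [Finset.sum_add_distrib]; simp [wt]
  rw [this]
  refine Finset.sum_le_sum fun j _ => ?_
  simp only [Finsupp.add_apply, Finsupp.single_apply, pow_zero, Nat.div_one]
  split_ifs <;> omega

lemma sq_indI (I : Finset (Fin n)) : sqTot n (monomial (indI I) 1) - monomial (indI I) 1 ∈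
    RS n {b | wt b 0 < I.card} := by
  rw [mon_indI]
  induction I using Finset.induction_on with
  | empty => simp
  | insert k I hk ih =>
    rw [Finset.prod_insert hk, map_mul, sqTot_X]
    set r := sqTot n (∏ i ∈ I, X i) - ∏ i ∈ I, X i with hr
    have e : (X k + X k ^ 2) * sqTot n (∏ i ∈ I, X i) - X k * ∏ i ∈ I, X i =
        monomial (single k 1) 1 * r + monomial (single k 2) 1 * monomial (indI I) 1
          + monomial (single k 2) 1 * r := by
      rw [← X_sq, mon_indI]
      change _ = X k * r + _ + _
      rw [hr]; ring
    have h2 : ∀ b : Fin n →₀ ℕ, wt (single k 2 + b) 0 = wt b 0 := by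
      intro b
      have : single k 2 + b = b + 2 • single k 1 := by simp [add_comm]
      rw [this, wt0_add_two]
    rw [e, Finset.card_insert_of_notMem hk, monomial_mul, one_mul]
    refine add_mem (add_mem (RS_mul _ ?_ ih) (RS_mon ?_)) (RS_mul _ ?_ ih)
    · intro b hb
      have := wt0_add_single b k
      rw [add_comm] at this
      simp only [Set.mem_ofPred_eq] at hb ⊢
      omega
    · simp only [Set.mem_ofPred_eq, h2, wt0_indI]; omega
    · intro b hb
      simp only [Set.mem_ofPred_eq, h2] at hb ⊢
      omega

def Phi (I : Finset (Fin n)) : P n →ₗ[ZMod 2] P n :=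
  LinearMap.mulLeft (ZMod 2) (monomial (indI I) (1 : ZMod 2)) ∘ₗ
    (expand (R := ZMod 2) (σ := Fin n) 2).toLinearMap

lemma Phi_apply (I : Finset (Fin n)) (p : P n) : Phi I p = monomial (indI I) 1 * p ^ 2 := by
  simp [Phi, MvPolynomial.expand_zmod]

lemma Phi_mon (I : Finset (Fin n)) (c : Fin n →₀ ℕ) :
    Phi I (monomial c 1) = monomial (indI I + 2 • c) 1 := by
  rw [Phi_apply, monomial_pow, monomial_mul, one_pow, one_mul]

lemma hc_Phi (I : Finset (Fin n)) (d : ℕ) (p : P n) :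
    homogeneousComponent (I.card + 2 * d) (Phi I p) = Phi I (homogeneousComponent d p) := by
  have := RS_map (N := ⊥) (homogeneousComponent (I.card + 2 * d) ∘ₗ Phi I -
    Phi I ∘ₗ homogeneousComponent d) (fun b _ => ?_) (mem_univ_RS p)
  · simpa [sub_eq_zero] using this
  · simp only [LinearMap.sub_apply, LinearMap.comp_apply, Phi_mon, hc_mon, Submodule.mem_bot]
    have h1 : (indI I + 2 • b).degree = I.card + 2 * b.degree := by
      simp [deg_indI]
    rw [h1]
    by_cases h : b.degree = d
    · rw [if_pos (by omega), if_pos h, Phi_mon, sub_self]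
    · rw [if_neg (by omega), if_neg h, map_zero, sub_self]

lemma Phi_hit (I : Finset (Fin n)) (d : ℕ) {p : P n} (hp : p ∈ hitS n) :
    Phi I (homogeneousComponent d p) ∈
      hitS n ⊔ RS n {b | wt b 0 < I.card ∧ b.degree = I.card + 2 * d} := by
  set N := hitS n ⊔ RS n {b | wt b 0 < I.card ∧ b.degree = I.card + 2 * d} with hN
  have key : ∀ (h : P n) (d' : ℕ), h.IsHomogeneous d' → d' < d →
      Phi I (homogeneousComponent d (sqTot n h)) ∈ N := by
    intro h d' hh hd
    have e : sqTot n (Phi I h) = Phi I (sqTot n h) +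
        (sqTot n (monomial (indI I) 1) - monomial (indI I) 1) * sqTot n h ^ 2 := by
      rw [Phi_apply, Phi_apply, map_mul, map_pow]; ring
    have h1 : homogeneousComponent (I.card + 2 * d) (sqTot n (Phi I h)) ∈ hitS n := by
      apply hit_hc (d := I.card + 2 * d') _ (by omega)
      rw [Phi_apply]
      refine (isHomogeneous_monomial (n := I.card) _ (deg_indI I)).mul ?_
      have := hh.pow 2
      rwa [mul_comm] at this
    have h2 : (sqTot n (monomial (indI I) 1) - monomial (indI I) 1) * sqTot n h ^ 2 ∈
        RS n {b | wt b 0 < I.card} := by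
      refine RS_map (LinearMap.mulRight (ZMod 2) (sqTot n h ^ 2)) (fun b hb => ?_) (sq_indI I)
      rw [LinearMap.mulRight_apply, ← MvPolynomial.expand_zmod]
      refine RS_map (LinearMap.mulLeft (ZMod 2) (monomial b (1 : ZMod 2)) ∘ₗ
        (expand (R := ZMod 2) (σ := Fin n) 2).toLinearMap) (fun c _ => ?_)
        (mem_univ_RS (sqTot n h))
      simp only [LinearMap.comp_apply, AlgHom.toLinearMap_apply, LinearMap.mulLeft_apply,
        MvPolynomial.expand_zmod, monomial_pow, monomial_mul, one_pow, one_mul]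
      apply RS_mon
      simp only [Set.mem_ofPred_eq, wt0_add_two] at hb ⊢
      exact hb
    have h3 := RS_hc (I.card + 2 * d) h2
    rw [e, map_add, hc_Phi] at h1
    have := sub_mem (Submodule.mem_sup_left h1 : _ ∈ N) (Submodule.mem_sup_right h3 : _ ∈ N)
    simpa using this
  have : hitS n ≤ N.comap (Phi I ∘ₗ homogeneousComponent d) := by
    rw [hitS, Submodule.span_le]
    rintro _ ⟨j, hj, h, rfl⟩
    simp only [SetLike.mem_coe, Submodule.mem_comap, LinearMap.comp_apply, SqK, map_sum]
    refine sum_mem fun d' _ => ?_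
    rw [homogeneousComponent_of_mem (homogeneousComponent_isHomogeneous (d' + j) _)]
    split_ifs with hd
    · rw [← hd]
      exact key _ d' (homogeneousComponent_isHomogeneous _ _) (by omega)
    · simp
  exact this hp

lemma wt_succ (I : Finset (Fin n)) (c : Fin n →₀ ℕ) (i : ℕ) :
    wt (indI I + 2 • c) (i + 1) = wt c i := by
  refine Finset.sum_congr rfl fun j _ => ?_
  rw [pow_succ', ← Nat.div_div_eq_div_mul]
  congr 2
  simp only [Finsupp.add_apply, Finsupp.smul_apply, indI_apply, smul_eq_mul]
  split_ifs <;> omega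

lemma wt_zero' (I : Finset (Fin n)) (c : Fin n →₀ ℕ) :
    wt (indI I + 2 • c) 0 = I.card := by
  rw [wt0_add_two, wt0_indI]

lemma wt_zero_eq (I : Finset (Fin n)) {b c : Fin n →₀ ℕ} (j : ℕ)
    (h : ∀ i, i + 1 = j → wt b i = wt c i) :
    wt (indI I + 2 • b) j = wt (indI I + 2 • c) j := by
  cases j with
  | zero => rw [wt_zero', wt_zero']
  | succ j => rw [wt_succ, wt_succ, h j rfl]

lemma monLt_Phi (I : Finset (Fin n)) {b c : Fin n →₀ ℕ} (h : monLt b c) :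
    monLt (indI I + 2 • b) (indI I + 2 • c) := by
  rcases h with ⟨i, h1, h2⟩ | ⟨h1, j, h2, h3⟩
  · refine Or.inl ⟨i + 1, fun j hj => wt_zero_eq I j fun k hk => h1 k (by omega), ?_⟩
    rwa [wt_succ, wt_succ]
  · refine Or.inr ⟨?_, j, fun k hk => ?_, ?_⟩
    · funext k
      exact wt_zero_eq I k fun i _ => by rw [h1]
    · simp [h2 k hk]
    · simp [h3]

lemma deg_Phi (I : Finset (Fin n)) (b : Fin n →₀ ℕ) :
    (indI I + 2 • b).degree = I.card + 2 * b.degree := by simp [deg_indI]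

lemma inadm_Phi (I : Finset (Fin n)) {c : Fin n →₀ ℕ} (h : Inadmissible c) :
    Inadmissible (indI I + 2 • c) := by
  obtain ⟨S, hS, hp⟩ := h
  have h1 := Phi_hit I c.degree hp
  have e : homogeneousComponent c.degree ((monomial c 1 : P n) + ∑ b ∈ S, monomial b 1) =
      (monomial c 1 : P n) + ∑ b ∈ S, monomial b 1 := by
    rw [map_add, map_sum, hc_mon, if_pos rfl]
    congr 1
    refine Finset.sum_congr rfl fun b hb => ?_
    rw [hc_mon, if_pos]
    rw [← mdeg_eq, ← mdeg_eq, (hS b hb).1]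
  rw [e, map_add, map_sum, Phi_mon] at h1
  have h2 : RS n {b | wt b 0 < I.card ∧ b.degree = I.card + 2 * c.degree} ≤
      RS n (Lower (indI I + 2 • c)) := by
    intro p hp
    refine RS_mono (t := Lower (indI I + 2 • c))
      (fun b hb => ⟨?_, Or.inl ⟨0, fun j hj => by omega, ?_⟩⟩) hp
    · rw [mdeg_eq, mdeg_eq, deg_Phi]; exact hb.2
    · rw [wt_zero']; exact hb.1
  have h3 := sup_le_sup_left h2 (hitS n) h1
  have h4 : ∑ b ∈ S, Phi I (monomial b 1) ∈ hitS n ⊔ RS n (Lower (indI I + 2 • c)) := by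
    refine sum_mem fun b hb => Submodule.mem_sup_right ?_
    rw [Phi_mon]
    refine RS_mon ⟨?_, monLt_Phi I (hS b hb).2⟩
    have := (hS b hb).1
    rw [mdeg_eq, mdeg_eq] at this ⊢
    rw [deg_Phi, deg_Phi, this]
  apply inadm_of
  simpa using sub_mem h3 h4

def hfv (a : Fin n →₀ ℕ) : Fin n →₀ ℕ := Finsupp.mapRange (· / 2) (Nat.zero_div 2) a

lemma decomp (a : Fin n →₀ ℕ) :
    ∃ I : Finset (Fin n), a = indI I + 2 • hfv a ∧ I.card = wt a 0 := by
  have h : a = indI (Finset.univ.filter fun j => a j % 2 = 1) + 2 • hfv a := by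
    ext j
    simp only [Finsupp.add_apply, Finsupp.smul_apply, indI_apply, smul_eq_mul, hfv,
      Finsupp.mapRange_apply, Finset.mem_filter, Finset.mem_univ, true_and]
    split_ifs <;> omega
  refine ⟨_, h, ?_⟩
  conv_rhs => rw [h]
  rw [wt_zero']

lemma adm_hfv {a : Fin n →₀ ℕ} (h : Admissible a) : Admissible (hfv a) := by
  obtain ⟨I, h1, _⟩ := decomp a
  intro h2
  apply h
  rw [h1]
  exact inadm_Phi I h2

lemma deg_hfv (a : Fin n →₀ ℕ) : mdeg a = wt a 0 + 2 * mdeg (hfv a) := by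
  obtain ⟨I, h1, h2⟩ := decomp a
  rw [← h2, mdeg_eq, mdeg_eq, ← deg_Phi, ← h1]

lemma wt_hfv (a : Fin n →₀ ℕ) (i : ℕ) : wt a (i + 1) = wt (hfv a) i := by
  obtain ⟨I, h1, h2⟩ := decomp a
  conv_lhs => rw [h1]
  rw [wt_succ]

lemma wt_le (a : Fin 5 →₀ ℕ) (i : ℕ) : wt a i ≤ 5 := by
  unfold wt
  rw [Fin.sum_univ_five]; omega

lemma not_one (a : Fin n →₀ ℕ) (ha : Admissible a) (S : ℕ)
    (h1 : ∀ s < S, 2 ^ s < mdeg (hfv a) + 1)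
    (h2 : mdeg (hfv a) + 1 < 2 ^ S) : wt a 0 ≠ 1 := by
  intro hw
  obtain ⟨I, h3, h4⟩ := decomp a
  rw [hw, Finset.card_eq_one] at h4
  obtain ⟨i, rfl⟩ := h4
  apply ha
  apply inadm_of_hit
  rw [h3]
  have : indI {i} = single i 1 := by simp [indI]
  rw [this]
  rw [mdeg_eq] at h1 h2
  exact one_hit i _ S h1 h2

lemma not_zero (a : Fin n →₀ ℕ) (ha : Admissible a) (h1 : 0 < mdeg (hfv a)) : wt a 0 ≠ 0 := by
  intro hw
  obtain ⟨I, h3, h4⟩ := decomp a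
  rw [hw, Finset.card_eq_zero] at h4
  subst h4
  apply ha
  apply inadm_of_hit
  rw [h3]
  have : indI (∅ : Finset (Fin n)) = 0 := by simp [indI]
  rw [this, zero_add]
  rw [mdeg_eq] at h1
  exact sq_mon_hit _ h1

lemma wt_of_deg_zero {a : Fin n →₀ ℕ} (h : mdeg a = 0) (i : ℕ) : wt a i = 0 := by
  rw [mdeg_eq, Finsupp.degree_eq_zero_iff] at h
  subst h
  simp [wt]

lemma not_35 (a : Fin 5 →₀ ℕ) (ha : Admissible a) (h0 : wt a 0 = 3) : wt a 1 ≠ 5 := by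
  intro h1
  have hall : ∀ j, a j / 2 % 2 = 1 := by
    simp only [wt, Fin.sum_univ_five] at h1
    intro j
    fin_cases j <;> simp <;> omega
  obtain ⟨l, hl⟩ : ∃ l, a l % 2 = 0 := by
    by_contra! hcon
    simp only [wt, Fin.sum_univ_five] at h0
    have := hcon 0
    have := hcon 1
    have := hcon 2
    have := hcon 3
    have := hcon 4
    omega
  have hl2 := hall l
  have hle : single l 1 ≤ a := by
    rw [Finsupp.single_le_iff]; omega
  set b := a - single l 1 with hb
  have hba : b + single l 1 = a := tsub_add_cancel_of_le hle
  have hbl : b l + 1 = a l := by rw [← hba]; simp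
  have hbj : ∀ j, j ≠ l → b j = a j := by
    intro j hj
    rw [← hba]; simp [Finsupp.single_apply, hj.symm]
  apply ha
  apply inadm_of
  have hh := sq_one_hit b
  rw [← Finset.add_sum_erase _ _ (Finset.mem_univ l), hba] at hh
  have hl1 : (b l : ZMod 2) = 1 := by
    rw [ZMod.natCast_eq_one_iff_odd, Nat.odd_iff]
    omega
  rw [hl1, one_smul] at hh
  have h4 : ∑ i ∈ Finset.univ.erase l, (b i : ZMod 2) • (monomial (b + single i 1) 1 : P 5) ∈
      RS 5 (Lower a) := by
    refine sum_mem fun i hi => ?_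
    have hil : i ≠ l := Finset.ne_of_mem_erase hi
    by_cases hodd : b i % 2 = 1
    · refine Submodule.smul_mem _ _ (RS_mon ⟨?_, Or.inl ⟨1, ?_, ?_⟩⟩)
      · rw [← hba, mdeg_eq, mdeg_eq]; simp
      · intro j hj
        obtain rfl : j = 0 := by omega
        unfold wt
        rw [← Equiv.sum_comp (Equiv.swap i l)]
        refine Finset.sum_congr rfl fun j _ => ?_
        have hai := hbj i hil
        by_cases h5 : j = i
        · subst h5
          rw [Equiv.swap_apply_left]
          simp [Finsupp.single_apply, hil]
          omega
        · by_cases h6 : j = l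
          · subst h6
            rw [Equiv.swap_apply_right]
            simp
            omega
          · rw [Equiv.swap_apply_of_ne_of_ne h5 h6]
            simp [Finsupp.single_apply, Ne.symm h5, hbj j h6]
      · unfold wt
        refine Finset.sum_lt_sum (fun j _ => ?_) ⟨l, Finset.mem_univ _, ?_⟩
        · have := hall j
          rw [pow_one, this]; omega
        · simp [Finsupp.single_apply, hil]
          omega
    · have : (b i : ZMod 2) = 0 := by
        rw [ZMod.natCast_eq_zero_iff]; omega
      rw [this, zero_smul]
      exact zero_mem _
  have := sub_mem (Submodule.mem_sup_left hh : _ ∈ hitS 5 ⊔ RS 5 (Lower a))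
    (Submodule.mem_sup_right h4)
  simpa using this

lemma not_5 (a : Fin 5 →₀ ℕ) (hadm : Admissible a) (hker : psi (monomial a 1) ∈ hitS 5) :
    wt a 0 ≠ 5 := by
  intro h
  have hodd : ∀ j, Odd (a j) := by
    simp only [wt, Fin.sum_univ_five] at h
    intro j
    rw [Nat.odd_iff]
    fin_cases j <;> simp <;> omega
  have : psi (monomial a 1) = monomial (hfv a) 1 := by
    have := (basisMonomials (Fin 5) (ZMod 2)).constr_basis (ZMod 2) (fun a : Fin 5 →₀ ℕ =>
      if ∀ j, Odd (a j) then
        (monomial (Finsupp.mapRange (· / 2) (Nat.zero_div 2) a) 1 : P 5) else 0) a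
    rw [if_pos hodd] at this
    rw [coe_basisMonomials] at this
    exact this
  rw [this] at hker
  exact adm_hfv hadm (inadm_of_hit hker)

end Helpers

/-- If `x` is an admissible monomial of degree 25 in `P_5` whose class lies
in the kernel of Kameko's homomorphism `(QP_5)_25 → (QP_5)_10` (equivalently, `ψ(x)` is
hit), then `ω(x) = (3,3,2,1)` or `ω(x) = (3,3,4)`. -/
theorem statement4 (a : Fin 5 →₀ ℕ) (hdeg : mdeg a = 25) (hadm : Admissible a)
    (hker : psi (monomial a 1) ∈ hitS 5) :
    wt a = w3321 ∨ wt a = w334 := by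
  have d0 := deg_hfv a
  have d1 := deg_hfv (hfv a)
  have d2 := deg_hfv (hfv (hfv a))
  have d3 := deg_hfv (hfv (hfv (hfv a)))
  have l0 := wt_le a 0
  have l1 := wt_le (hfv a) 0
  have l2 := wt_le (hfv (hfv a)) 0
  have n5 := not_5 a hadm hker
  have a1 := adm_hfv hadm
  have a2 := adm_hfv a1
  have w0 : wt a 0 = 3 := by
    have : wt a 0 ≠ 1 := by
      intro h
      have hd : mdeg (hfv a) = 12 := by omega
      refine not_one a hadm 4 ?_ ?_ h
      · rw [hd]; decide
      · rw [hd]; decide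
    omega
  have hd1 : mdeg (hfv a) = 11 := by omega
  have w1 : wt (hfv a) 0 = 3 := by
    have h1 : wt (hfv a) 0 ≠ 1 := by
      intro h
      have hd : mdeg (hfv (hfv a)) = 5 := by omega
      refine not_one (hfv a) a1 3 ?_ ?_ h
      · rw [hd]; decide
      · rw [hd]; decide
    have h2 := not_35 a hadm w0
    rw [wt_hfv] at h2
    omega
  have hd2 : mdeg (hfv (hfv a)) = 4 := by omega
  have h0 : wt (hfv (hfv a)) 0 ≠ 0 := by
    intro h
    exact not_zero _ a2 (by omega) h
  have hw : wt (hfv (hfv a)) 0 = 2 ∨ wt (hfv (hfv a)) 0 = 4 := by omega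
  rcases hw with hw | hw
  · left
    funext i
    have hd3 : mdeg (hfv (hfv (hfv a))) = 1 := by omega
    match i with
    | 0 => rw [w0]; rfl
    | 1 => rw [wt_hfv, w1]; rfl
    | 2 => rw [wt_hfv, wt_hfv, hw]; rfl
    | 3 =>
      rw [wt_hfv, wt_hfv, wt_hfv]
      have : wt (hfv (hfv (hfv a))) 0 = 1 := by omega
      rw [this]; rfl
    | k + 4 =>
      rw [wt_hfv, wt_hfv, wt_hfv, wt_hfv, wt_of_deg_zero (by omega)]
      simp [w3321]
  · right
    funext i
    match i with
    | 0 => rw [w0]; rfl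
    | 1 => rw [wt_hfv, w1]; rfl
    | 2 => rw [wt_hfv, wt_hfv, hw]; rfl
    | k + 3 =>
      rw [wt_hfv, wt_hfv, wt_hfv, wt_of_deg_zero (by omega)]
      simp [w334]
end
end

section
/- Each of the following twenty-seven monomials of degree 17 in P_5 is strictly inadmissible: x_1x_2^2x_3^6x_4x_5^7, x_1x_2^2x_3^6x_4^7x_5, x_1x_2^2x_3^7x_4^6x_5, x_1x_2^6x_3^2x_4x_5^7, x_1x_2^6x_3^2x_4^7x_5, x_1x_2^6x_3^7x_4^2x_5, x_1x_2^7x_3^2x_4^6x_5, x_1x_2^7x_3^6x_4^2x_5, x_1^7x_2x_3^2x_4^6x_5, x_1^7x_2x_3^6x_4^2x_5, x_1x_2^6x_3^3x_4^6x_5, x_1x_2^6x_3^6x_4x_5^3, x_1x_2^6x_3^6x_4^3x_5, x_1x_2^2x_3^2x_4^5x_5^7, x_1x_2^2x_3^2x_4^7x_5^5, x_1x_2^2x_3^7x_4^2x_5^5, x_1x_2^7x_3^2x_4^2x_5^5, x_1^7x_2x_3^2x_4^2x_5^5, x_1x_2^2x_3^6x_4^3x_5^5, x_1x_2^2x_3^6x_4^5x_5^3,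 x_1x_2^6x_3^2x_4^3x_5^5, x_1x_2^6x_3^2x_4^5x_5^3, x_1x_2^6x_3^3x_4^2x_5^5, x_1x_2^6x_3^3x_4^4x_5^3, x_1^3x_2^4x_3x_4^6x_5^3, x_1^3x_2^4x_3^3x_4^3x_5^4, x_1^3x_2^4x_3^3x_4^4x_5^3. -/
open MvPolynomial

noncomputable section

abbrev M5 : Type := ℕ × ℕ × ℕ × ℕ × ℕ

def toF5 (m : M5) : Fin 5 →₀ ℕ := ev ![m.1, m.2.1, m.2.2.1, m.2.2.2.1, m.2.2.2.2]

def pol5 (L : List M5) : P 5 := (L.map fun m => (monomial (toF5 m) 1 : P 5)).sum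

def dg5 (m : M5) : ℕ := m.1 + m.2.1 + m.2.2.1 + m.2.2.2.1 + m.2.2.2.2

def wb5 (m : M5) (i : ℕ) : ℕ :=
  m.1 / 2 ^ i % 2 + m.2.1 / 2 ^ i % 2 + m.2.2.1 / 2 ^ i % 2 + m.2.2.2.1 / 2 ^ i % 2
    + m.2.2.2.2 / 2 ^ i % 2

def totL1 (a : ℕ) : List ℕ :=
  ((List.range (a + 1)).filter fun i => Nat.choose a i % 2 == 1).map fun i => a + i

def totL (m : M5) : List M5 :=
  totL1 m.1 ×ˢ (totL1 m.2.1 ×ˢ (totL1 m.2.2.1 ×ˢ (totL1 m.2.2.2.1 ×ˢ totL1 m.2.2.2.2)))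

def sqL (j : ℕ) (m : M5) : List M5 := (totL m).filter fun p => dg5 p == dg5 m + j

def lexB : List ℕ → List ℕ → Bool
  | a :: l, b :: k => Nat.blt a b || (Nat.beq a b && lexB l k)
  | _, _ => false

def key5 (m : M5) : List ℕ :=
  [wb5 m 0, wb5 m 1, wb5 m 2, wb5 m 3, wb5 m 4, m.1, m.2.1, m.2.2.1, m.2.2.2.1, m.2.2.2.2]

def ltB (m t : M5) : Bool :=
  Nat.beq (dg5 m) (dg5 t) && Nat.blt (dg5 t) 32 && lexB (key5 m) (key5 t)

def tog (m : M5) (L : List M5) : List M5 := if m ∈ L then L.erase m else m :: L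

def bigL (C : List (ℕ × M5)) : List M5 := C.flatMap fun c => sqL c.1 c.2

def chk (t : M5) (C : List (ℕ × M5)) : Bool :=
  (C.all fun c => Nat.blt 0 c.1 && Nat.blt c.1 8) &&
  (((bigL C).filter fun m => !ltB m t).foldr tog [] == [t]) &&
  (Nat.blt t.1 8 && Nat.blt t.2.1 8 && Nat.blt t.2.2.1 8 && Nat.blt t.2.2.2.1 8 &&
    Nat.blt t.2.2.2.2 8) && Nat.blt 0 (wb5 t 2)

theorem toF5_sum (m : M5) : ∑ j, toF5 m j = dg5 m := by
  simp [toF5, ev, dg5, Fin.sum_univ_five]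

theorem wt_toF5 (m : M5) (i : ℕ) : wt (toF5 m) i = wb5 m i := by
  simp [wt, toF5, ev, wb5, Fin.sum_univ_five]

theorem ltB_sound {m t : M5} (h : ltB m t = true) :
    mdeg (toF5 m) = mdeg (toF5 t) ∧ monLt (toF5 m) (toF5 t) := by
  simp only [ltB, Bool.and_eq_true, Nat.beq_eq, Nat.blt_eq] at h
  obtain ⟨⟨h1, h2⟩, h3⟩ := h
  refine ⟨by rw [mdeg, mdeg, toF5_sum, toF5_sum, h1], ?_⟩
  have big : ∀ i, 5 ≤ i → wb5 m i = wb5 t i := by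
    intro i hi
    have hp : 32 ≤ 2 ^ i := by
      calc 32 = 2 ^ 5 := by norm_num
        _ ≤ 2 ^ i := Nat.pow_le_pow_right (by norm_num) hi
    unfold dg5 at h1 h2
    unfold wb5
    rw [Nat.div_eq_of_lt (a := m.1) (by omega), Nat.div_eq_of_lt (a := m.2.1) (by omega),
      Nat.div_eq_of_lt (a := m.2.2.1) (by omega), Nat.div_eq_of_lt (a := m.2.2.2.1) (by omega),
      Nat.div_eq_of_lt (a := m.2.2.2.2) (by omega), Nat.div_eq_of_lt (a := t.1) (by omega),
      Nat.div_eq_of_lt (a := t.2.1) (by omega), Nat.div_eq_of_lt (a := t.2.2.1) (by omega),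
      Nat.div_eq_of_lt (a := t.2.2.2.1) (by omega), Nat.div_eq_of_lt (a := t.2.2.2.2) (by omega)]
  simp only [key5, lexB, Bool.or_eq_true, Bool.and_eq_true, Nat.beq_eq, Nat.blt_eq,
    Bool.false_eq_true, and_false, or_false] at h3
  have W : ∀ i, (∀ j, j < i → wb5 m j = wb5 t j) → wb5 m i < wb5 t i →
      monLt (toF5 m) (toF5 t) := by
    intro i h h'
    refine Or.inl ⟨i, ?_, ?_⟩
    · intro j hj; rw [wt_toF5, wt_toF5, h j hj]
    · rw [wt_toF5, wt_toF5]; exact h'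
  rcases h3 with h | ⟨e0, h | ⟨e1, h | ⟨e2, h | ⟨e3, h | ⟨e4, h⟩⟩⟩⟩⟩
  · exact W 0 (by intro j hj; omega) h
  · exact W 1 (by intro j hj; interval_cases j; assumption) h
  · exact W 2 (by intro j hj; interval_cases j <;> assumption) h
  · exact W 3 (by intro j hj; interval_cases j <;> assumption) h
  · exact W 4 (by intro j hj; interval_cases j <;> assumption) h
  · refine Or.inr ⟨?_, ?_⟩
    · funext i
      rw [wt_toF5, wt_toF5]
      by_cases hi : 5 ≤ i
      · exact big i hi
      · have : i < 5 := by omega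
        interval_cases i <;> assumption
    · have g0 : ∀ m : M5, toF5 m 0 = m.1 := fun m => by simp [toF5, ev]
      have g1 : ∀ m : M5, toF5 m 1 = m.2.1 := fun m => by simp [toF5, ev]
      have g2 : ∀ m : M5, toF5 m 2 = m.2.2.1 := fun m => by simp [toF5, ev]
      have g3 : ∀ m : M5, toF5 m 3 = m.2.2.2.1 := fun m => by simp [toF5, ev]
      have g4 : ∀ m : M5, toF5 m 4 = m.2.2.2.2 := fun m => by simp [toF5, ev]
      rcases h with h | ⟨f0, h | ⟨f1, h | ⟨f2, h | ⟨f3, h⟩⟩⟩⟩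
      · refine ⟨0, ?_, by rw [g0, g0]; exact h⟩
        intro k hk; fin_cases k <;> simp_all
      · refine ⟨1, ?_, by rw [g1, g1]; exact h⟩
        intro k hk; fin_cases k <;> simp_all
      · refine ⟨2, ?_, by rw [g2, g2]; exact h⟩
        intro k hk; fin_cases k <;> simp_all
      · refine ⟨3, ?_, by rw [g3, g3]; exact h⟩
        intro k hk; fin_cases k <;> simp_all
      · refine ⟨4, ?_, by rw [g4, g4]; exact h⟩
        intro k hk; fin_cases k <;> simp_all

theorem pol5_cons (m : M5) (L : List M5) : pol5 (m :: L) = monomial (toF5 m) 1 + pol5 L := by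
  simp [pol5]

theorem pol5_append (L K : List M5) : pol5 (L ++ K) = pol5 L + pol5 K := by
  simp [pol5]

theorem p5_self (f : P 5) : f + f = 0 := CharTwo.add_self_eq_zero f

theorem pol5_tog (m : M5) (L : List M5) : pol5 (tog m L) = monomial (toF5 m) 1 + pol5 L := by
  unfold tog
  split_ifs with h
  · have h2 : pol5 L = monomial (toF5 m) 1 + pol5 (L.erase m) := by
      rw [← pol5_cons]
      exact ((List.perm_cons_erase h).map _).sum_eq
    rw [h2, ← add_assoc, p5_self, zero_add]
  · exact pol5_cons m L

theorem pol5_foldr (L : List M5) : pol5 (L.foldr tog []) = pol5 L := by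
  induction L with
  | nil => rfl
  | cons m L ih => rw [List.foldr_cons, pol5_tog, ih, pol5_cons]

theorem pol5_split (p : M5 → Bool) (L : List M5) :
    pol5 L = pol5 (L.filter p) + pol5 (L.filter fun m => !p m) := by
  induction L with
  | nil => simp [pol5]
  | cons m L ih =>
    rw [pol5_cons, ih]
    cases h : p m
    · simp only [List.filter_cons, h, Bool.not_false, if_true, pol5_cons, Bool.false_eq_true,
        if_false]
      ring
    · simp only [List.filter_cons, h, Bool.not_true, if_true, pol5_cons, Bool.false_eq_true,
        if_false]
      ring

theorem sum_prod_list {α β : Type} (L : List α) (K : List β) (f : α → P 5) (g : β → P 5) :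
    ((L ×ˢ K).map fun p => f p.1 * g p.2).sum = (L.map f).sum * (K.map g).sum := by
  induction L with
  | nil => simp
  | cons a L ih =>
    rw [List.product_cons, List.map_append, List.sum_append, ih, List.map_cons, List.sum_cons,
      add_mul, List.map_map]
    congr 1
    rw [← List.sum_map_mul_left]
    rfl

theorem filt_sum (L : List ℕ) (a : ℕ) (f : ℕ → P 5) :
    ((L.filter fun i => Nat.choose a i % 2 == 1).map f).sum
      = (L.map fun i => f i * (Nat.choose a i : P 5)).sum := by
  induction L with
  | nil => rfl
  | cons i L ih =>
    rw [List.map_cons, List.sum_cons, ← ih]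
    rcases Nat.mod_two_eq_zero_or_one (Nat.choose a i) with h | h
    · have : (Nat.choose a i : P 5) = 0 := (CharP.cast_eq_zero_iff (P 5) 2 _).2
        (Nat.dvd_of_mod_eq_zero h)
      simp [h, this]
    · have : (Nat.choose a i : P 5) = 1 := by
        rw [← Nat.div_add_mod (Nat.choose a i) 2, h]
        push_cast
        have h2 : (2 : P 5) = 0 := CharTwo.two_eq_zero
        rw [h2]; simp
      simp [h, this]

theorem tot1 (i : Fin 5) (a : ℕ) :
    (X i + X i ^ 2 : P 5) ^ a = ((totL1 a).map fun e => (X i : P 5) ^ e).sum := by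
  have h : (X i + X i ^ 2 : P 5) = X i * (X i + 1) := by ring
  have hl : ∀ (n : ℕ) (f : ℕ → P 5), ∑ i ∈ Finset.range n, f i = ((List.range n).map f).sum :=
    fun n f => rfl
  rw [h, mul_pow, add_pow, totL1, List.map_map, filt_sum, Finset.mul_sum, ← hl]
  refine Finset.sum_congr rfl fun k _ => ?_
  simp only [Function.comp, one_pow, mul_one, pow_add, mul_assoc]

theorem mon5_eq (m : M5) : (monomial (toF5 m) 1 : P 5) =
    X 0 ^ m.1 * (X 1 ^ m.2.1 * (X 2 ^ m.2.2.1 * (X 3 ^ m.2.2.2.1 * X 4 ^ m.2.2.2.2))) := by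
  rw [monomial_eq, Finsupp.prod_fintype _ _ (by simp), Fin.prod_univ_five]
  simp [toF5, ev, mul_assoc]

theorem sqTot_mon (m : M5) : sqTot 5 (monomial (toF5 m) 1) = pol5 (totL m) := by
  rw [mon5_eq]
  simp only [map_mul, map_pow, sqTot, bind₁_X_right, tot1]
  simp only [← sum_prod_list]
  simp only [pol5, totL, mon5_eq]

theorem hom_mon (m : M5) : IsHomogeneous (monomial (toF5 m) 1 : P 5) (dg5 m) := by
  apply isHomogeneous_monomial
  rw [← toF5_sum, Finsupp.degree_eq_sum]

theorem hc_pol (d : ℕ) (L : List M5) :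
    homogeneousComponent d (pol5 L) = pol5 (L.filter fun p => dg5 p == d) := by
  induction L with
  | nil => simp [pol5]
  | cons m L ih =>
    rw [pol5_cons, map_add, ih, List.filter_cons]
    rw [homogeneousComponent_of_mem (hom_mon m)]
    by_cases h : dg5 m = d
    · simp [h, pol5_cons]
    · have h' : ¬ d = dg5 m := fun e => h e.symm
      simp [h, h']

theorem SqK_mon (j : ℕ) (m : M5) : SqK 5 j (monomial (toF5 m) 1) = pol5 (sqL j m) := by
  have hne : (monomial (toF5 m) 1 : P 5) ≠ 0 := by simp
  rw [SqK, (hom_mon m).totalDegree hne, Finset.sum_eq_single (dg5 m)]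
  · rw [homogeneousComponent_of_mem (hom_mon m), if_pos rfl, sqTot_mon, hc_pol, sqL]
  · intro d _ hd
    rw [homogeneousComponent_of_mem (hom_mon m), if_neg hd]
    simp
  · intro h; simp at h

theorem bigL_mem (C : List (ℕ × M5))
    (h : (C.all fun c => Nat.blt 0 c.1 && Nat.blt c.1 8) = true) :
    pol5 (bigL C) ∈ AplusS 5 3 := by
  induction C with
  | nil => simp [bigL, pol5]
  | cons c C ih =>
    rw [List.all_cons, Bool.and_eq_true, Bool.and_eq_true, Nat.blt_eq, Nat.blt_eq] at h
    have e : bigL (c :: C) = sqL c.1 c.2 ++ bigL C := by simp [bigL]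
    rw [e, pol5_append]
    refine Submodule.add_mem _ (Submodule.subset_span ?_) (ih h.2)
    exact ⟨c.1, h.1.1, by simpa using h.1.2, _, (SqK_mon c.1 c.2).symm⟩

theorem supp_pol (L : List M5) (b : Fin 5 →₀ ℕ) (hb : b ∈ (pol5 L).support) :
    ∃ m ∈ L, b = toF5 m := by
  induction L with
  | nil => simp [pol5] at hb
  | cons m L ih =>
    rw [pol5_cons] at hb
    rcases Finset.mem_union.1 (support_add hb) with h | h
    · have := support_monomial_subset h
      exact ⟨m, by simp, by simpa using this⟩
    · obtain ⟨k, hk, e⟩ := ih h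
      exact ⟨k, by simp [hk], e⟩

theorem chk_sound (t : M5) (C : List (ℕ × M5)) (h : chk t C = true) :
    StrictlyInadmissible (toF5 t) := by
  simp only [chk, Bool.and_eq_true, beq_iff_eq, Nat.blt_eq] at h
  obtain ⟨⟨⟨h1, h2⟩, ⟨⟨⟨⟨b1, b2⟩, b3⟩, b4⟩, b5⟩⟩, h4⟩ := h
  refine ⟨3, by norm_num, ?_, ?_, (pol5 ((bigL C).filter fun m => ltB m t)).support, ?_, ?_⟩
  · rw [wt_toF5]; exact Nat.pos_iff_ne_zero.1 h4
  · intro i hi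
    have hp : 8 ≤ 2 ^ i := by
      calc 8 = 2 ^ 3 := by norm_num
        _ ≤ 2 ^ i := Nat.pow_le_pow_right (by norm_num) hi
    rw [wt_toF5, wb5, Nat.div_eq_of_lt (by omega), Nat.div_eq_of_lt (by omega),
      Nat.div_eq_of_lt (by omega), Nat.div_eq_of_lt (by omega), Nat.div_eq_of_lt (by omega)]
  · intro b hb
    obtain ⟨m, hm, rfl⟩ := supp_pol _ _ hb
    exact ltB_sound (List.mem_filter.1 hm).2
  · have key := bigL_mem C h1
    rw [pol5_split (fun m => ltB m t)] at key
    rw [← pol5_foldr (List.filter (fun m => !ltB m t) _), h2, add_comm] at key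
    have e1 : pol5 [t] = monomial (toF5 t) 1 := by simp [pol5]
    rw [e1] at key
    convert key using 2
    conv_rhs => rw [(pol5 ((bigL C).filter fun m => ltB m t)).as_sum]
    refine Finset.sum_congr rfl fun b hb => ?_
    have hz : ∀ z : ZMod 2, z ≠ 0 → z = 1 := by decide
    rw [hz _ (mem_support_iff.1 hb)]

def certs : List (M5 × List (ℕ × M5)) := [
  ((1,2,6,1,7), [(1,1,4,3,1,7), (2,2,1,3,2,7), (1,4,1,3,1,7), (2,1,2,3,2,7), (1,1,1,3,4,7), (1,1,1,5,2,7), (1,1,2,5,1,7), (2,2,2,3,1,7)]),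
  ((1,2,6,7,1), [(1,4,1,3,7,1), (2,2,2,3,7,1), (1,2,1,5,7,1), (1,1,4,3,7,1), (1,1,1,6,7,1), (2,1,2,3,7,2), (1,1,1,3,7,4), (2,2,1,3,7,2)]),
  ((1,2,7,6,1), [(1,1,1,7,5,2), (1,4,1,7,3,1), (2,1,2,7,3,2), (1,1,2,7,5,1), (1,1,4,7,3,1), (2,2,1,7,3,2), (1,1,1,7,3,4), (2,2,2,7,3,1)]),
  ((1,6,2,1,7), [(2,2,3,1,2,7), (1,1,3,1,4,7), (1,4,3,1,1,7), (1,1,5,2,1,7), (1,1,5,1,2,7), (1,1,3,4,1,7), (2,2,3,2,1,7)]),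
  ((1,6,2,7,1), [(2,2,3,2,7,1), (1,1,3,1,7,4), (2,2,3,1,7,2), (1,4,3,1,7,1), (1,1,6,1,7,1), (1,2,5,1,7,1), (1,1,3,4,7,1)]),
  ((1,6,7,2,1), [(1,1,3,7,1,4), (2,2,3,7,2,1), (2,2,3,7,1,2), (1,1,6,7,1,1), (1,4,3,7,1,1), (1,2,5,7,1,1), (1,1,3,7,4,1)]),
  ((1,7,2,6,1), [(1,2,7,1,5,1), (2,1,7,2,3,2), (1,1,7,1,6,1), (1,4,7,1,3,1), (2,2,7,1,3,2), (2,2,7,2,3,1), (1,1,7,1,3,4), (1,1,7,4,3,1)]),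
  ((1,7,6,2,1), [(2,2,7,3,1,2), (2,2,7,3,2,1), (1,1,7,6,1,1), (1,4,7,3,1,1), (1,2,7,5,1,1), (1,1,7,3,4,1), (1,1,7,3,1,4)]),
  ((7,1,2,6,1), [(1,7,4,1,3,1), (1,7,1,1,5,2), (1,7,1,2,5,1), (2,7,2,1,3,2), (2,7,1,2,3,2), (1,7,1,1,3,4), (1,7,1,4,3,1), (2,7,2,2,3,1)]),
  ((7,1,6,2,1), [(1,7,4,3,1,1), (1,7,1,3,1,4), (2,7,2,3,2,1), (1,7,1,3,4,1), (1,7,1,5,1,2), (2,7,2,3,1,2), (1,7,1,5,2,1)]),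
  ((1,6,3,6,1), [(1,1,3,5,6,1), (1,1,5,3,5,2), (1,1,3,5,5,2), (1,1,3,3,5,4), (1,4,3,3,5,1), (1,1,5,3,6,1), (2,2,3,3,6,1), (2,2,3,3,5,2)]),
  ((1,6,6,1,3), [(1,1,6,5,1,3), (1,1,5,5,2,3), (1,2,5,3,1,5), (2,2,5,3,2,3), (1,1,5,3,1,6), (2,2,6,3,1,3), (1,4,5,3,1,3), (1,1,5,3,4,3)]),
  ((1,6,6,3,1), [(1,1,3,5,5,2), (1,1,3,6,5,1), (1,1,3,5,3,4), (1,1,5,5,3,2), (1,4,3,5,3,1), (1,1,5,6,3,1), (2,2,3,6,3,1), (2,2,3,5,3,2)]),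
  ((1,2,2,5,7), [(1,1,1,4,3,7), (1,1,1,1,6,7), (1,4,1,1,3,7), (2,2,2,1,3,7), (1,2,1,1,5,7), (2,2,1,2,3,7), (1,1,4,1,3,7), (2,1,2,2,3,7)]),
  ((1,2,2,7,5), [(2,2,2,1,7,3), (2,2,1,2,7,3), (1,1,4,1,7,3), (1,4,1,1,7,3), (1,2,1,1,7,5), (1,1,1,1,7,6), (2,1,2,2,7,3), (1,1,1,4,7,3)]),
  ((1,2,7,2,5), [(1,1,2,7,1,5), (1,1,1,7,2,5), (2,2,2,7,1,3), (1,1,1,7,4,3), (1,4,1,7,1,3), (2,1,2,7,2,3), (1,1,4,7,1,3), (2,2,1,7,2,3)]),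
  ((1,7,2,2,5), [(1,1,7,1,4,3), (1,1,7,4,1,3), (2,2,7,2,1,3), (1,1,7,1,1,6), (2,1,7,2,2,3), (1,2,7,1,1,5), (1,4,7,1,1,3), (2,2,7,1,2,3)]),
  ((7,1,2,2,5), [(1,7,1,4,1,3), (2,7,2,2,1,3), (1,7,4,1,1,3), (2,7,1,2,2,3), (1,7,1,1,4,3), (2,7,2,1,2,3), (1,7,1,1,2,5), (1,7,1,2,1,5)]),
  ((1,2,6,3,5), [(1,1,2,3,5,5), (1,1,1,5,3,6), (2,1,2,3,3,6), (1,1,1,3,5,6), (1,1,2,5,3,5), (1,1,4,3,3,5), (1,4,1,3,3,5), (2,2,1,3,3,6), (2,2,2,3,3,5)]),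
  ((1,2,6,5,3), [(1,1,1,6,3,5), (1,1,2,5,3,5), (1,1,2,5,5,3), (1,1,4,5,3,3), (1,1,1,6,5,3), (2,1,2,6,3,3), (1,4,1,5,3,3), (2,2,1,6,3,3), (2,2,2,5,3,3)]),
  ((1,6,2,3,5), [(1,1,3,2,5,5), (1,1,3,4,3,5), (1,1,5,1,3,6), (1,1,3,1,5,6), (1,1,5,2,3,5), (1,4,3,1,3,5), (2,2,3,1,3,6), (2,2,3,2,3,5)]),
  ((1,6,2,5,3), [(1,1,3,4,5,3), (1,1,5,2,5,3), (2,2,3,2,5,3), (1,2,3,1,5,5), (1,4,3,1,5,3), (1,1,3,1,5,6), (1,1,5,1,6,3), (2,2,3,1,6,3)]),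
  ((1,6,3,2,5), [(1,1,3,3,4,5), (1,1,3,5,1,6), (1,1,5,3,1,6), (1,1,3,5,2,5), (1,4,3,3,1,5), (1,1,5,3,2,5), (2,2,3,3,1,6), (2,2,3,3,2,5)]),
  ((1,6,3,4,3), [(1,1,4,3,5,3), (2,2,3,4,3,3), (1,1,3,4,5,3), (1,1,3,3,5,4), (1,1,3,5,3,4), (2,1,6,2,3,3), (1,1,3,3,4,5), (1,1,4,3,3,5), (2,2,3,3,4,3), (1,1,4,5,3,3), (1,1,3,4,3,5), (1,1,5,3,3,4), (1,4,3,3,3,3), (1,1,5,4,3,3), (2,2,3,3,3,4), (2,2,4,3,3,3), (1,1,3,5,4,3), (1,1,5,3,4,3)]),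
  ((3,4,1,6,3), [(1,3,3,4,3,3), (2,2,3,4,3,3), (1,3,4,1,5,3), (1,3,4,1,3,5), (2,5,2,2,3,3), (4,3,2,2,3,3)]),
  ((3,4,3,3,4), [(2,2,3,3,3,4), (1,3,3,3,3,4)]),
  ((3,4,3,4,3), [(2,2,3,3,4,3), (1,3,3,3,4,3)])]

theorem certs_ok : (certs.all fun c => chk c.1 c.2) = true := by decide +kernel

theorem certs_all (c) (hc : c ∈ certs) : StrictlyInadmissible (toF5 c.1) :=
  chk_sound c.1 c.2 (List.all_eq_true.1 certs_ok c hc)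


/-- Each of the twenty-seven listed monomials of degree 17 in `P_5` is
strictly inadmissible. -/
theorem statement8 :
    ∀ v ∈ ([![1,2,6,1,7], ![1,2,6,7,1], ![1,2,7,6,1], ![1,6,2,1,7], ![1,6,2,7,1],
            ![1,6,7,2,1], ![1,7,2,6,1], ![1,7,6,2,1], ![7,1,2,6,1], ![7,1,6,2,1],
            ![1,6,3,6,1], ![1,6,6,1,3], ![1,6,6,3,1], ![1,2,2,5,7], ![1,2,2,7,5],
            ![1,2,7,2,5], ![1,7,2,2,5], ![7,1,2,2,5], ![1,2,6,3,5], ![1,2,6,5,3],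
            ![1,6,2,3,5], ![1,6,2,5,3], ![1,6,3,2,5], ![1,6,3,4,3], ![3,4,1,6,3],
            ![3,4,3,3,4], ![3,4,3,4,3]] : List (Fin 5 → ℕ)),
      StrictlyInadmissible (ev v) := by
  have key : ∀ t ∈ certs.map Prod.fst, StrictlyInadmissible (toF5 t) := by
    intro t ht
    obtain ⟨c, hc, rfl⟩ := List.mem_map.1 ht
    exact certs_all c hc
  simp only [certs, List.not_mem_nil, false_imp_iff, imp_true_iff, and_true, List.map_cons, List.map_nil, List.forall_mem_cons, toF5] at key
  simp only [List.forall_mem_cons, List.not_mem_nil, false_imp_iff, imp_true_iff, and_true]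
  exact key
end
end

section
/- Let n ≥ 1 and 1 ≤ ℓ ≤ n, and let ω be the weight vector with ω_i = n−1 for 1 ≤ i ≤ ℓ, ω_{ℓ+1} = 1, and ω_i = 0 for i > ℓ+1 (this is ω(X_ℓ^{2^ℓ−1} x_ℓ^{2^ℓ})). Then X_ℓ^{2^ℓ−1} x_ℓ^{2^ℓ} + Σ_{u=ℓ}^{n} Σ_{(i;I)∈N_{ℓ−1}} φ_{(i;I∪u)}(X^{2^ℓ−1}) x_u^{2^ℓ} + Σ_{u=ℓ+1}^{n} X_u^{2^ℓ−1} x_u^{2^ℓ} ∈ A_ℓ^+P_n + P_n^−(ω). (Here the inner sum is over pairs (i;I) ∈ N_{ℓ−1}, regarded inside N_n, and is empty when ℓ = 1.) -/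
open MvPolynomial

noncomputable section

/-- all exponents as function -/
def mon9 {n : ℕ} (e : Fin n → ℕ) : P n := monomial (ev e) 1

def unit9 (n u : ℕ) : Fin n → ℕ := fun k => if (k : ℕ) + 1 = u then 1 else 0

def E9 {n : ℕ} : List ℕ → (Fin n → ℕ) → (Fin n → ℕ)
  | [], z => z
  | c :: l, z => fun k => (if (k : ℕ) + 1 = c then 0 else 1) + 2 * E9 l z k

def InR9 (n : ℕ) (l : List ℕ) : Prop := ∀ c ∈ l, 1 ≤ c ∧ c ≤ n

theorem E9_append {n : ℕ} (p s : List ℕ) (z : Fin n → ℕ) : E9 (p ++ s) z = E9 p (E9 s z) := by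
  induction p with
  | nil => rfl
  | cons c p ih => simp only [List.cons_append, E9, ih]

theorem lucas9 (a b : ℕ) (h : Odd (a.choose b)) :
    Odd ((a % 2).choose (b % 2)) ∧ Odd ((a / 2).choose (b / 2)) := by
  have : Fact (Nat.Prime 2) := ⟨Nat.prime_two⟩
  have := Choose.choose_modEq_choose_mod_mul_choose_div_nat (n := a) (k := b) (p := 2)
  have h2 : Odd ((a % 2).choose (b % 2) * (a / 2).choose (b / 2)) := by
    rw [Nat.odd_iff] at h ⊢
    rw [← h]; exact this.symm
  exact Nat.odd_mul.mp h2

theorem lucas9' (a b p : ℕ) (h : Odd (a.choose b)) :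
    Odd ((a / 2 ^ p).choose (b / 2 ^ p)) := by
  induction p with
  | zero => simpa using h
  | succ p ih =>
    have := (lucas9 _ _ ih).2
    rwa [Nat.div_div_eq_div_mul, Nat.div_div_eq_div_mul, ← pow_succ] at this

theorem odd_of_choose9 (a b : ℕ) (h : Odd (a.choose b)) (hb : b % 2 = 1) : a % 2 = 1 := by
  have := (lucas9 _ _ h).1
  rw [hb] at this
  rcases Nat.mod_two_eq_zero_or_one a with h | h
  · rw [h] at this; simp at this
  · exact h

theorem cast_choose9 (a k : ℕ) : ((a.choose (2 ^ k) : ℕ) : ZMod 2) = if (a / 2 ^ k) % 2 = 1 then 1 else 0 := by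
  have : Fact (Nat.Prime 2) := ⟨Nat.prime_two⟩
  have key : ∀ k a, a.choose (2 ^ k) % 2 = (a / 2 ^ k) % 2 := by
    intro k
    induction k with
    | zero => intro a; simp
    | succ k ih =>
      intro a
      have := Choose.choose_modEq_choose_mod_mul_choose_div_nat (n := a) (k := 2 ^ (k + 1)) (p := 2)
      have h1 : 2 ^ (k + 1) % 2 = 0 := by omega
      have h2 : 2 ^ (k + 1) / 2 = 2 ^ k := by omega
      rw [h1, h2, Nat.choose_zero_right, one_mul] at this
      have h3 : a.choose (2 ^ (k + 1)) % 2 = (a / 2).choose (2 ^ k) % 2 := this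
      rw [h3, ih, Nat.div_div_eq_div_mul, ← pow_succ']
  have h := key k a
  split_ifs with h1
  · rw [h1] at h
    rw [← ZMod.natCast_mod, h]; simp
  · have : (a / 2 ^ k) % 2 = 0 := by omega
    rw [this] at h
    rw [← ZMod.natCast_mod, h]; simp

/-- the weight drops -/
theorem drop9 {n : ℕ} (a b : Fin n → ℕ) (p : ℕ) (hb : ∀ j, 2 ^ p ∣ b j)
    (hb' : ∃ j, ¬ 2 ^ (p + 1) ∣ b j) (hc : ∀ j, Odd ((a j).choose (b j))) :
    (∀ i < p, wt (ev (a + b)) i = wt (ev a) i) ∧ wt (ev (a + b)) p < wt (ev a) p := by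
  have hev : ∀ (e : Fin n → ℕ) j, (ev e) j = e j := fun e j => rfl
  constructor
  · intro i hi
    unfold wt
    refine Finset.sum_congr rfl fun j _ => ?_
    simp only [hev, Pi.add_apply]
    obtain ⟨c, hc⟩ := hb j
    have : b j = 2 ^ i * (2 * (2 ^ (p - i - 1) * c)) := by
      rw [hc, ← mul_assoc, ← mul_assoc, ← pow_succ, ← pow_add]; congr 2; omega
    rw [this, Nat.add_mul_div_left _ _ (by positivity)]
    omega
  · unfold wt
    have hd : ∀ j, (a j + b j) / 2 ^ p = a j / 2 ^ p + b j / 2 ^ p := by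
      intro j
      obtain ⟨c, hc⟩ := hb j
      rw [hc, Nat.add_mul_div_left _ _ (by positivity), Nat.mul_div_cancel_left _ (by positivity)]
    have ho : ∀ j, (b j / 2 ^ p) % 2 = 1 → (a j / 2 ^ p) % 2 = 1 := fun j h =>
      odd_of_choose9 _ _ (lucas9' _ _ p (hc j)) h
    obtain ⟨j0, hj0⟩ := hb'
    refine Finset.sum_lt_sum (fun j _ => ?_) ⟨j0, Finset.mem_univ _, ?_⟩
    · simp only [hev, Pi.add_apply, hd]
      have := ho j
      omega
    · simp only [hev, Pi.add_apply, hd]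
      have := ho j0
      have h1 : (b j0 / 2 ^ p) % 2 = 1 := by
        by_contra h
        apply hj0
        have h2 : 2 ∣ b j0 / 2 ^ p := by omega
        rw [pow_succ]
        exact (Nat.dvd_div_iff_mul_dvd (hb j0)).mp h2
      omega

theorem mon9_mul {n : ℕ} (a b : Fin n → ℕ) : mon9 a * mon9 b = mon9 (a + b) := by
  unfold mon9
  rw [monomial_mul, one_mul]
  have : ev a + ev b = ev (a + b) := by ext j; rfl
  rw [this]

theorem mon9_prod {n : ℕ} (a : Fin n → ℕ) : mon9 a = ∏ j, (X j : P n) ^ a j := by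
  unfold mon9
  rw [monomial_eq, Finsupp.prod_fintype]
  · simp; rfl
  · simp

theorem sqTot_mon9 {n : ℕ} (a : Fin n → ℕ) (N : ℕ) :
    sqTot n (mon9 a) = ∑ b ∈ Fintype.piFinset (fun j : Fin n => Finset.range (a j + 1 + N)),
      (∏ j, ((a j).choose (b j) : ZMod 2)) • mon9 (a + b) := by
  rw [mon9_prod]
  simp only [sqTot, map_prod, map_pow, bind₁_X_right]
  have h : ∀ j : Fin n, ((X j : P n) + X j ^ 2) ^ a j =
      ∑ b ∈ Finset.range (a j + 1 + N), ((a j).choose b : ZMod 2) • (X j : P n) ^ (a j + b) := by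
    intro j
    have : (X j : P n) + X j ^ 2 = X j * (X j + 1) := by ring
    rw [this, mul_pow, add_pow, Finset.mul_sum]
    refine Finset.sum_subset_zero_on_sdiff ?_ ?_ ?_
    · intro x; simp only [Finset.mem_range]; omega
    · intro x hx
      simp only [Finset.mem_sdiff, Finset.mem_range] at hx
      rw [Nat.choose_eq_zero_of_lt (by omega)]; simp
    · intro x hx
      rw [smul_eq_C_mul]; simp; ring
  simp only [h]
  rw [Finset.prod_univ_sum]
  refine Finset.sum_congr rfl fun b _ => ?_
  rw [mon9_prod, Finset.prod_smul]; rfl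

theorem mon9_hom {n : ℕ} (a : Fin n → ℕ) : (mon9 a).IsHomogeneous (∑ j, a j) := by
  unfold mon9
  apply isHomogeneous_monomial
  rw [Finsupp.degree_eq_sum]; rfl

theorem SqK_mon9 {n : ℕ} (k : ℕ) (a : Fin n → ℕ) (N : ℕ) :
    SqK n k (mon9 a) = ∑ b ∈ (Fintype.piFinset (fun j : Fin n => Finset.range (a j + 1 + N))).filter
      (fun b => ∑ j, b j = k),
      (∏ j, ((a j).choose (b j) : ZMod 2)) • mon9 (a + b) := by
  unfold SqK
  have hne : (mon9 a) ≠ 0 := by unfold mon9; simp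
  rw [(mon9_hom a).totalDegree hne]
  rw [Finset.sum_eq_single (∑ j, a j)]
  · rw [homogeneousComponent_of_mem (mon9_hom a), if_pos rfl, sqTot_mon9 a N, map_sum, Finset.sum_filter]
    refine Finset.sum_congr rfl fun b _ => ?_
    rw [map_smul, homogeneousComponent_of_mem (mon9_hom (a + b))]
    simp only [Pi.add_apply, Finset.sum_add_distrib, add_right_inj]
    by_cases hb : ∑ j, b j = k
    · rw [if_pos hb, if_pos hb.symm]
    · rw [if_neg hb, if_neg (Ne.symm hb), smul_zero]
  · intro d _ hd
    rw [homogeneousComponent_of_mem (mon9_hom a), if_neg hd]; simp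
  · simp

def N9 (n ℓ : ℕ) : Submodule (ZMod 2) (P n) :=
  AplusS n ℓ ⊔ PnLt n ((n - 1) * (2 ^ ℓ - 1) + 2 ^ ℓ) (wSpike n ℓ)

def q9 (n ℓ : ℕ) : P n →ₗ[ZMod 2] (P n ⧸ N9 n ℓ) := (N9 n ℓ).mkQ

theorem q9_zero {n ℓ : ℕ} (f : P n) : q9 n ℓ f = 0 ↔ f ∈ N9 n ℓ := by
  unfold q9; simp

theorem q9_low {n ℓ : ℕ} (e : Fin n → ℕ) (hd : ∑ j, e j = (n - 1) * (2 ^ ℓ - 1) + 2 ^ ℓ)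
    (p : ℕ) (hp : p < ℓ) (h1 : ∀ i < p, wt (ev e) i = n - 1) (h2 : wt (ev e) p < n - 1) :
    q9 n ℓ (mon9 e) = 0 := by
  rw [q9_zero]
  refine Submodule.mem_sup_right (Submodule.subset_span ⟨ev e, hd, ⟨p, ?_, ?_⟩, rfl⟩)
  · intro i hi
    rw [h1 i hi]; unfold wSpike; rw [if_pos (by omega)]
  · unfold wSpike; rw [if_pos hp]; exact h2

theorem sum_ind9 (n c : ℕ) (hc : 1 ≤ c ∧ c ≤ n) :
    ∑ k : Fin n, (if (k : ℕ) + 1 = c then 1 else 0) = 1 := by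
  rw [Finset.sum_eq_single (⟨c - 1, by omega⟩ : Fin n)]
  · rw [if_pos]; simp; omega
  · intro b _ hb
    rw [if_neg]; intro h; apply hb; ext; simp; omega
  · simp

theorem sum_ind9' (n c : ℕ) (hc : 1 ≤ c ∧ c ≤ n) :
    ∑ k : Fin n, (if (k : ℕ) + 1 = c then 0 else 1) = n - 1 := by
  have h := sum_ind9 n c hc
  have : ∑ k : Fin n, (if (k : ℕ) + 1 = c then 0 else 1) + ∑ k : Fin n, (if (k : ℕ) + 1 = c then 1 else 0) = n := by
    rw [← Finset.sum_add_distrib]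
    rw [Finset.sum_congr rfl (g := fun _ => 1)]
    · simp
    · intro x _; split_ifs <;> rfl
  omega

theorem wt_E9_zero {n : ℕ} (l : List ℕ) (c : ℕ) (hc : 1 ≤ c ∧ c ≤ n) (z : Fin n → ℕ) :
    wt (ev (E9 (c :: l) z)) 0 = n - 1 := by
  rw [← sum_ind9' n c hc]
  unfold wt
  refine Finset.sum_congr rfl fun j _ => ?_
  change ((if (j : ℕ) + 1 = c then 0 else 1) + 2 * E9 l z j) / 2 ^ 0 % 2 = _
  split_ifs <;> omega

theorem wt_E9_succ {n : ℕ} (l : List ℕ) (c : ℕ) (z : Fin n → ℕ) (i : ℕ) :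
    wt (ev (E9 (c :: l) z)) (i + 1) = wt (ev (E9 l z)) i := by
  unfold wt
  refine Finset.sum_congr rfl fun j _ => ?_
  change ((if (j : ℕ) + 1 = c then 0 else 1) + 2 * E9 l z j) / 2 ^ (i + 1) % 2 = (E9 l z j) / 2 ^ i % 2
  rw [pow_succ', ← Nat.div_div_eq_div_mul]
  congr 2
  split_ifs <;> omega

theorem wt_E9_lt {n : ℕ} (l : List ℕ) (hl : InR9 n l) (z : Fin n → ℕ) :
    ∀ i < l.length, wt (ev (E9 l z)) i = n - 1 := by
  induction l with
  | nil => intro i hi; simp at hi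
  | cons c l ih =>
    intro i hi
    cases i with
    | zero => exact wt_E9_zero l c (hl c (by simp)) z
    | succ i =>
      rw [wt_E9_succ]
      exact ih (fun d hd => hl d (by simp [hd])) i (by simpa using hi)

theorem wt_E9_ge {n : ℕ} (l : List ℕ) (z : Fin n → ℕ) :
    wt (ev (E9 l z)) l.length = wt (ev z) 0 := by
  induction l with
  | nil => rfl
  | cons c l ih => rw [List.length_cons, wt_E9_succ, ih]

theorem deg_E9 {n : ℕ} (l : List ℕ) (hl : InR9 n l) (z : Fin n → ℕ) :
    ∑ k, E9 l z k = (n - 1) * (2 ^ l.length - 1) + 2 ^ l.length * ∑ k, z k := by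
  have key : ∑ k, E9 l z k + (n - 1) = (n - 1) * 2 ^ l.length + 2 ^ l.length * ∑ k, z k := by
    induction l with
    | nil => simp [E9]; omega
    | cons c l ih =>
      have := ih (fun d hd => hl d (by simp [hd]))
      simp only [E9, Finset.sum_add_distrib, ← Finset.mul_sum, List.length_cons]
      rw [sum_ind9' n c (hl c (by simp)), pow_succ]
      nlinarith
  have : 1 ≤ 2 ^ l.length := Nat.one_le_two_pow
  rw [Nat.mul_sub, mul_one]
  have h2 : (n - 1) * 1 ≤ (n - 1) * 2 ^ l.length := Nat.mul_le_mul_left _ this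
  omega

theorem E9_add {n : ℕ} (l : List ℕ) (y e : Fin n → ℕ) (k : Fin n) :
    E9 l (y + e) k = E9 l y k + 2 ^ l.length * e k := by
  induction l with
  | nil => simp [E9]
  | cons c l ih => simp only [E9, ih, List.length_cons, pow_succ]; ring

theorem E9_div {n : ℕ} (l : List ℕ) (y : Fin n → ℕ) (k : Fin n) :
    E9 l y k / 2 ^ l.length = y k := by
  induction l with
  | nil => simp [E9]
  | cons c l ih =>
    simp only [E9, List.length_cons]
    rw [pow_succ', ← Nat.div_div_eq_div_mul, ← ih]
    congr 1
    split_ifs <;> omega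

theorem relA9 {n ℓ : ℕ} (p : List ℕ) (hp : InR9 n p) (hpl : p.length < ℓ) (y : Fin n → ℕ)
    (hd : ∑ j, E9 p y j + 2 ^ p.length = (n - 1) * (2 ^ ℓ - 1) + 2 ^ ℓ) :
    ∑ j : Fin n, (if y j % 2 = 1 then q9 n ℓ (mon9 (E9 p (y + Pi.single j 1))) else 0) = 0 := by
  have h0 : q9 n ℓ (SqK n (2 ^ p.length) (mon9 (E9 p y))) = 0 := by
    rw [q9_zero]
    refine Submodule.mem_sup_left (Submodule.subset_span ⟨2 ^ p.length, Nat.one_le_two_pow, ?_, _, rfl⟩)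
    exact Nat.pow_lt_pow_right (by norm_num) hpl
  rw [SqK_mon9 _ _ (2 ^ p.length), map_sum] at h0
  refine Eq.trans ?_ h0
  refine Finset.sum_of_injOn (fun j => Pi.single j (2 ^ p.length)) ?_ ?_ ?_ ?_
  · intro i _ j _ h
    by_contra hij
    have := congrFun h i
    simp [Pi.single_apply, hij] at this
  · intro j _
    simp only [Finset.coe_filter, Set.mem_ofPred_eq, Fintype.mem_piFinset, Finset.mem_range]
    constructor
    · intro i
      have : 0 < 2 ^ p.length := by positivity
      rw [Pi.single_apply]; split_ifs <;> omega
    · simp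
  · intro b hb hb'
    simp only [Finset.mem_filter] at hb
    rw [map_smul]
    by_cases hodd : ∀ j, Odd ((E9 p y j).choose (b j))
    · have hex : ∃ t, ∃ j, ¬ 2 ^ (t + 1) ∣ b j := by
        by_contra hcon
        push Not at hcon
        have hz : ∀ j, b j = 0 := by
          intro j
          by_contra hne
          have := Nat.le_of_dvd (Nat.pos_of_ne_zero hne) (hcon (b j) j)
          have h2 := (Nat.lt_two_pow_self (n := b j + 1))
          omega
        have := hb.2
        simp [hz] at this
        exact absurd this.symm (by positivity)
      classical
      have ht := Nat.find_spec hex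
      have hmin : ∀ j, 2 ^ (Nat.find hex) ∣ b j := by
        intro j
        rcases Nat.eq_zero_or_pos (Nat.find hex) with h | h
        · rw [h]; simp
        · have := Nat.find_min hex (m := Nat.find hex - 1) (by omega)
          push Not at this
          have h2 := this j
          rwa [Nat.sub_add_cancel h] at h2
      set t := Nat.find hex
      have htl : t < p.length := by
        by_contra hge
        push Not at hge
        have hdv : ∀ j, 2 ^ p.length ∣ b j := fun j => (pow_dvd_pow 2 hge).trans (hmin j)
        obtain ⟨j, hj⟩ := ht
        have hjne : b j ≠ 0 := by intro h; rw [h] at hj; simp at hj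
        have hjge := Nat.le_of_dvd (Nat.pos_of_ne_zero hjne) (hdv j)
        apply hb'
        refine ⟨j, by simp, ?_⟩
        have hs := hb.2
        rw [← Finset.add_sum_erase _ _ (Finset.mem_univ j)] at hs
        have hz : ∑ i ∈ Finset.univ.erase j, b i = 0 := by omega
        rw [Finset.sum_eq_zero_iff] at hz
        funext i
        simp only [Pi.single_apply]
        split_ifs with h
        · subst h; omega
        · exact (hz i (by simp [h])).symm
      have hdrop := drop9 _ _ t hmin ht hodd
      rw [q9_low _ _ t (by omega), smul_zero]
      · intro i hi
        rw [hdrop.1 i hi]; exact wt_E9_lt p hp y i (by omega)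
      · rw [← wt_E9_lt p hp y t htl]; exact hdrop.2
      · simp only [Pi.add_apply, Finset.sum_add_distrib]; rw [hb.2, hd]
    · push Not at hodd
      obtain ⟨j, hj⟩ := hodd
      rw [Finset.prod_eq_zero (Finset.mem_univ j), zero_smul]
      rw [Nat.not_odd_iff_even] at hj
      exact (ZMod.natCast_eq_zero_iff _ _).mpr hj.two_dvd
  · intro j _
    rw [map_smul, Finset.prod_eq_single j]
    · simp only [Pi.single_eq_same]
      rw [cast_choose9, E9_div]
      have : E9 p (y + Pi.single j 1) = E9 p y + Pi.single j (2 ^ p.length) := by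
        funext i
        rw [E9_add, Pi.add_apply, Pi.single_apply, Pi.single_apply]
        split_ifs <;> simp
      rw [this]
      split_ifs <;> simp
    · intro i _ hi
      rw [Pi.single_eq_of_ne hi]; simp
    · simp

theorem E9_rep {n : ℕ} (a c : ℕ) (z : Fin n → ℕ) (k : Fin n) :
    E9 (List.replicate a c) z k = (if (k : ℕ) + 1 = c then 0 else 2 ^ a - 1) + 2 ^ a * z k := by
  induction a with
  | zero => simp [E9]
  | succ a ih =>
    simp only [List.replicate_succ, E9, ih, pow_succ]
    have : 0 < 2 ^ a := by positivity
    split_ifs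
    · ring
    · rw [mul_add]
      have h2 : 2 ^ a * 2 * z k = 2 * (2 ^ a * z k) := by ring
      rw [h2]; omega

theorem relB9 {n ℓ : ℕ} (p : List ℕ) (hp : InR9 n p) (hpl : p.length < ℓ) (a : ℕ) (ha : 1 ≤ a)
    (z : Fin n → ℕ) (j0 : Fin n)
    (hd : ∑ k, E9 (p ++ List.replicate a ((j0 : ℕ) + 1)) (z + Pi.single j0 1) k
      = (n - 1) * (2 ^ ℓ - 1) + 2 ^ ℓ) :
    ∑ j : Fin n, q9 n ℓ (mon9 (E9 (p ++ List.replicate a ((j : ℕ) + 1)) (z + Pi.single j 1))) = 0 := by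
  have hpos : 0 < 2 ^ a := by positivity
  have key : ∀ j : Fin n, E9 (p ++ List.replicate a ((j : ℕ) + 1)) (z + Pi.single j 1)
      = E9 p ((fun k => 2 ^ a - 1 + 2 ^ a * z k) + Pi.single j 1) := by
    intro j
    rw [E9_append]
    congr 1
    funext k
    rw [E9_rep, Pi.add_apply, Pi.add_apply, Pi.single_apply]
    by_cases h : k = j
    · subst h; simp; rw [mul_add]; omega
    · have h2 : ¬ ((k : ℕ) + 1 = (j : ℕ) + 1) := fun h' => h (by ext; omega)
      simp [h, h2]
      intro h3; exact absurd h3 (fun h' => h (by ext; omega))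
  have := relA9 (ℓ := ℓ) p hp hpl (fun k => 2 ^ a - 1 + 2 ^ a * z k) (by
    rw [key] at hd
    rw [← hd]
    simp only [E9_add, Finset.sum_add_distrib, ← Finset.mul_sum]
    simp)
  rw [← this]
  refine Finset.sum_congr rfl fun j _ => ?_
  rw [if_pos, key]
  obtain ⟨b, rfl⟩ : ∃ b, a = b + 1 := ⟨a - 1, by omega⟩
  have h0 : 0 < 2 ^ b := by positivity
  have : 2 ^ (b + 1) * z j = 2 * (2 ^ b * z j) := by rw [pow_succ]; ring
  rw [this]; omega

def W9 (n ℓ : ℕ) (l : List ℕ) (u : ℕ) : P n ⧸ N9 n ℓ := q9 n ℓ (mon9 (E9 l (unit9 n u)))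

theorem deg_W9 {n ℓ : ℕ} (l : List ℕ) (hl : InR9 n l) (hll : l.length = ℓ) (u : ℕ)
    (hu : 1 ≤ u ∧ u ≤ n) :
    ∑ k, E9 l (unit9 n u) k = (n - 1) * (2 ^ ℓ - 1) + 2 ^ ℓ := by
  rw [deg_E9 l hl, hll]
  unfold unit9
  rw [sum_ind9 n u hu, mul_one]

theorem unit9_eq {n : ℕ} (j : Fin n) : unit9 n ((j : ℕ) + 1) = Pi.single j 1 := by
  funext k
  unfold unit9
  rw [Pi.single_apply]
  by_cases h : k = j
  · subst h; simp
  · rw [if_neg h, if_neg]; intro h'; exact h (by ext; omega)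

theorem InR9_append {n : ℕ} {p s : List ℕ} : InR9 n (p ++ s) ↔ InR9 n p ∧ InR9 n s := by
  unfold InR9; simp only [List.mem_append]
  constructor
  · intro h; exact ⟨fun c hc => h c (Or.inl hc), fun c hc => h c (Or.inr hc)⟩
  · rintro ⟨h1, h2⟩ c (hc | hc)
    · exact h1 c hc
    · exact h2 c hc

theorem InR9_rep {n a c : ℕ} (hc : 1 ≤ c ∧ c ≤ n) : InR9 n (List.replicate a c) := by
  intro d hd
  rw [List.eq_of_mem_replicate hd]; exact hc

theorem InR9_cons {n c : ℕ} {s : List ℕ} : InR9 n (c :: s) ↔ (1 ≤ c ∧ c ≤ n) ∧ InR9 n s := by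
  unfold InR9; simp

theorem relT9 {n ℓ : ℕ} (hn : 1 ≤ n) (p : List ℕ) (hp : InR9 n p) (a : ℕ) (ha : 1 ≤ a)
    (hl : p.length + a = ℓ) :
    ∑ j : Fin n, W9 n ℓ (p ++ List.replicate a ((j : ℕ) + 1)) ((j : ℕ) + 1) = 0 := by
  have := relB9 (ℓ := ℓ) p hp (by omega) a ha 0 (⟨0, by omega⟩ : Fin n) (by
    rw [← unit9_eq, zero_add (unit9 n _)]
    exact deg_W9 (n := n) (ℓ := ℓ) (p ++ List.replicate a (0 + 1))
      (InR9_append.mpr ⟨hp, InR9_rep ⟨by omega, by omega⟩⟩) (by simp [hl]) (0 + 1)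
      ⟨by omega, by omega⟩)
  rw [← this]
  refine Finset.sum_congr rfl fun j _ => ?_
  unfold W9
  rw [unit9_eq, zero_add]

theorem add_self9 {n ℓ : ℕ} (x : P n ⧸ N9 n ℓ) : x + x = 0 := by
  rw [← two_smul (ZMod 2) x]
  have : (2 : ZMod 2) = 0 := by decide
  rw [this, zero_smul]

theorem relS9 {n ℓ : ℕ} (p s : List ℕ) (hp : InR9 n p) (hs : InR9 n s) (a : ℕ) (ha : 1 ≤ a)
    (c d u : ℕ) (hc : 1 ≤ c ∧ c ≤ n) (hd : 1 ≤ d ∧ d ≤ n) (hu : 1 ≤ u ∧ u ≤ n)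
    (hl : p.length + a + 1 + s.length = ℓ) :
    W9 n ℓ (p ++ List.replicate a c ++ d :: s) u = W9 n ℓ (p ++ List.replicate a d ++ c :: s) u := by
  by_cases hcd : c = d
  · subst hcd; rfl
  obtain ⟨c, rfl⟩ : ∃ b, c = b + 1 := ⟨c - 1, by omega⟩
  obtain ⟨d, rfl⟩ : ∃ b, d = b + 1 := ⟨d - 1, by omega⟩
  set z : Fin n → ℕ := fun k => (if (k : ℕ) = c ∨ (k : ℕ) = d then 0 else 1) + 2 * E9 s (unit9 n u) k with hz
  have hzc : z + Pi.single (⟨c, by omega⟩ : Fin n) 1 = E9 ((d + 1) :: s) (unit9 n u) := by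
    funext k
    simp only [hz, Pi.add_apply, Pi.single_apply, E9, Fin.ext_iff]
    split_ifs <;> omega
  have hzd : z + Pi.single (⟨d, by omega⟩ : Fin n) 1 = E9 ((c + 1) :: s) (unit9 n u) := by
    funext k
    simp only [hz, Pi.add_apply, Pi.single_apply, E9, Fin.ext_iff]
    split_ifs <;> omega
  have hdeg : ∀ j : Fin n, ∑ k, E9 (p ++ List.replicate a ((j : ℕ) + 1)) (z + Pi.single j 1) k
      = (n - 1) * (2 ^ ℓ - 1) + 2 ^ ℓ := by
    have h1 : ∑ k, E9 (p ++ List.replicate a (c + 1)) (z + Pi.single (⟨c, by omega⟩ : Fin n) 1) k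
      = (n - 1) * (2 ^ ℓ - 1) + 2 ^ ℓ := by
      rw [hzc, ← E9_append]
      refine deg_W9 _ ?_ ?_ u hu
      · exact InR9_append.mpr ⟨InR9_append.mpr ⟨hp, InR9_rep hc⟩, InR9_cons.mpr ⟨hd, hs⟩⟩
      · simp; omega
    intro j
    rw [← h1, deg_E9 _ (InR9_append.mpr ⟨hp, InR9_rep (by have := j.isLt; omega)⟩),
      deg_E9 _ (InR9_append.mpr ⟨hp, InR9_rep hc⟩)]
    simp [Finset.sum_add_distrib]
  have := relB9 (ℓ := ℓ) p hp (by omega) a ha z ⟨c, by omega⟩ (hdeg _)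
  have hne : (⟨c, by omega⟩ : Fin n) ≠ ⟨d, by omega⟩ := by
    intro h; simp at h; omega
  rw [Finset.sum_eq_add _ _ hne ?_ (by simp) (by simp)] at this
  · unfold W9
    rw [E9_append _ (_ :: s), E9_append _ (_ :: s), ← hzc, ← hzd]
    exact add_right_cancel (this.trans (add_self9 _).symm)
  · intro j _ hj
    have hpr : InR9 n (p ++ List.replicate a ((j : ℕ) + 1)) :=
      InR9_append.mpr ⟨hp, InR9_rep (by have := j.isLt; omega)⟩
    refine q9_low _ (hdeg j) (p.length + a) (by omega) ?_ ?_
    · intro i hi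
      exact wt_E9_lt _ hpr _ i (by simpa using hi)
    · have h1 := wt_E9_ge (p ++ List.replicate a ((j : ℕ) + 1)) (z + Pi.single j 1)
      rw [List.length_append, List.length_replicate] at h1
      rw [h1, ← sum_ind9' n (c + 1) hc]
      unfold wt
      refine Finset.sum_lt_sum ?_ ⟨⟨d, by omega⟩, Finset.mem_univ _, ?_⟩
      · intro k _
        change (z + Pi.single j 1 : Fin n → ℕ) k / 2 ^ 0 % 2 ≤ _
        simp only [hz, Pi.add_apply, Pi.single_apply]
        by_cases hkj : k = j
        · subst hkj
          have h3 : (k : ℕ) ≠ c := fun h => hj.1 (by ext; exact h)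
          have h4 : (k : ℕ) ≠ d := fun h => hj.2 (by ext; exact h)
          simp [h3, h4]
          omega
        · rw [if_neg hkj]
          split_ifs <;> omega
      · change (z + Pi.single j 1 : Fin n → ℕ) ⟨d, _⟩ / 2 ^ 0 % 2 < _
        simp only [hz, Pi.add_apply, Pi.single_apply]
        rw [if_neg (Ne.symm hj.2)]
        have hdc : d ≠ c := by omega
        simp [hdc]

theorem perm9 {n ℓ : ℕ} (u : ℕ) (hu : 1 ≤ u ∧ u ≤ n) {l₁ l₂ : List ℕ} (h : l₁.Perm l₂) :
    ∀ p : List ℕ, InR9 n p → InR9 n l₁ → p.length + l₁.length = ℓ →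
      W9 n ℓ (p ++ l₁) u = W9 n ℓ (p ++ l₂) u := by
  induction h with
  | nil => intros; rfl
  | cons x _ ih =>
    intro p hp h1 hl
    have := ih (p ++ [x]) (InR9_append.mpr ⟨hp, InR9_cons.mpr ⟨(InR9_cons.mp h1).1, by simp [InR9]⟩⟩)
      (InR9_cons.mp h1).2 (by simp at hl ⊢; omega)
    simpa using this
  | swap x y l =>
    intro p hp h1 hl
    have h2 := InR9_cons.mp h1
    have h3 := InR9_cons.mp h2.2
    have := relS9 (ℓ := ℓ) p l hp h3.2 1 le_rfl y x u h2.1 h3.1 hu (by simp at hl; omega)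
    simpa using this
  | trans h1 h2 ih1 ih2 =>
    intro p hp hr hl
    rw [ih1 p hp hr hl]
    exact ih2 p hp (fun c hc => hr c (h1.mem_iff.mpr hc)) (by rw [← h1.length_eq]; exact hl)

def K9 (ℓ : ℕ) (K : Finset ℕ) (j : ℕ) : List ℕ := K.toList ++ List.replicate (ℓ - K.card) j

theorem K9_insert {n ℓ : ℕ} (K : Finset ℕ) (j : ℕ) (hj : 1 ≤ j ∧ j ≤ n) (hK : ∀ c ∈ K, 1 ≤ c ∧ c ≤ n)
    (hjK : j ∉ K) (hc : K.card < ℓ) :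
    W9 n ℓ (K9 ℓ (insert j K) j) j = W9 n ℓ (K9 ℓ K j) j := by
  have hp : (K9 ℓ K j).Perm (K9 ℓ (insert j K) j) := by
    unfold K9
    rw [Finset.card_insert_of_notMem hjK]
    obtain ⟨b, hb⟩ : ∃ b, ℓ - K.card = b + 1 := ⟨ℓ - K.card - 1, by omega⟩
    have hb' : ℓ - (K.card + 1) = b := by omega
    rw [hb, hb', List.replicate_succ]
    refine List.perm_middle.trans ?_
    rw [← List.cons_append]
    exact (Finset.toList_insert hjK).symm.append_right _
  have := perm9 (ℓ := ℓ) j hj hp [] (by simp [InR9]) (by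
    unfold K9; exact InR9_append.mpr ⟨fun c hc => hK c (by simpa using hc), InR9_rep hj⟩) (by
    simp [K9]; omega)
  simpa using this.symm

theorem sumK9 {n ℓ : ℕ} (hl1 : 1 ≤ ℓ) (hl2 : ℓ ≤ n) :
    ∑ u ∈ Finset.Icc ℓ n, ∑ K ∈ (Finset.Icc 1 (ℓ - 1)).powerset, W9 n ℓ (K9 ℓ K u) u = 0 := by
  have hcard : ∀ K ∈ (Finset.Icc 1 (ℓ - 1)).powerset, K.card ≤ ℓ - 1 := by
    intro K hK
    simpa using Finset.card_le_card (Finset.mem_powerset.mp hK)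
  have hin : ∀ K ∈ (Finset.Icc 1 (ℓ - 1)).powerset, ∀ c ∈ K, 1 ≤ c ∧ c ≤ n := by
    intro K hK c hc
    have := Finset.mem_Icc.mp (Finset.mem_powerset.mp hK hc)
    omega
  have hall : ∑ u ∈ Finset.Icc 1 n, ∑ K ∈ (Finset.Icc 1 (ℓ - 1)).powerset, W9 n ℓ (K9 ℓ K u) u = 0 := by
    rw [Finset.sum_comm]
    refine Finset.sum_eq_zero fun K hK => ?_
    have h := hcard K hK
    have := relT9 (n := n) (ℓ := ℓ) (by omega) K.toList (fun c hc => hin K hK c (by simpa using hc))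
      (ℓ - K.card) (by omega) (by simp; omega)
    rw [← this, Fin.sum_univ_eq_sum_range (fun j => W9 n ℓ (K.toList ++ List.replicate (ℓ - K.card) (j + 1)) (j + 1)) n,
      Finset.range_eq_Ico, Finset.sum_Ico_add' (fun j => W9 n ℓ (K.toList ++ List.replicate (ℓ - K.card) j) j)]
    rfl
  rw [← hall]
  refine Finset.sum_subset ?_ ?_
  · intro x; simp only [Finset.mem_Icc]; omega
  · intro j hj hj'
    simp only [Finset.mem_Icc] at hj hj'
    have hjm : j ∈ Finset.Icc 1 (ℓ - 1) := by simp only [Finset.mem_Icc]; omega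
    rw [← Finset.insert_erase hjm, Finset.sum_powerset_insert (Finset.notMem_erase _ _), ← Finset.sum_add_distrib]
    refine Finset.sum_eq_zero fun K hK => ?_
    have hK' : K ∈ (Finset.Icc 1 (ℓ - 1)).powerset :=
      Finset.mem_powerset.mpr ((Finset.mem_powerset.mp hK).trans (Finset.erase_subset _ _))
    have hjK : j ∉ K := fun h => Finset.notMem_erase _ _ (Finset.mem_powerset.mp hK h)
    have := hcard K hK'
    rw [K9_insert K j hj (hin K hK') hjK (by omega)]
    exact add_self9 _

theorem pow_split9 {M : Type*} [AddCommMonoid M] (m : ℕ) (f : Finset ℕ → M) (t : ℕ) :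
    ∀ a, m + 1 - a = t → ∑ K ∈ (Finset.Icc a m).powerset, f K = f ∅ +
      ∑ i ∈ Finset.Icc a m, ∑ S ∈ (Finset.Icc (i + 1) m).powerset, f (insert i S) := by
  induction t with
  | zero =>
    intro a ha
    rw [Finset.Icc_eq_empty (by omega)]; simp
  | succ t ih =>
    intro a ha
    have hI : Finset.Icc a m = insert a (Finset.Icc (a + 1) m) := by
      ext x; simp only [Finset.mem_Icc, Finset.mem_insert]; omega
    have hna : a ∉ Finset.Icc (a + 1) m := by simp
    rw [hI, Finset.sum_powerset_insert hna, Finset.sum_insert hna, ih (a + 1) (by omega)]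
    rw [add_assoc]; congr 1; rw [add_comm]

theorem Xj_mul9 (n u ℓ : ℕ) :
    XjMon n u (2 ^ ℓ - 1) * xvMon n u (2 ^ ℓ) = mon9 (E9 (List.replicate ℓ u) (unit9 n u)) := by
  have h1 : XjMon n u (2 ^ ℓ - 1) = mon9 (fun k : Fin n => if (k : ℕ) + 1 = u then 0 else 2 ^ ℓ - 1) := rfl
  have h2 : xvMon n u (2 ^ ℓ) = mon9 (fun k : Fin n => if (k : ℕ) + 1 = u then 2 ^ ℓ else 0) := rfl
  rw [h1, h2, mon9_mul]
  congr 1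
  funext k
  rw [E9_rep, Pi.add_apply]
  unfold unit9
  split_ifs <;> simp

def R9 : List ℕ → ℕ → ℕ
  | [], _ => 0
  | c :: l, k => (if k = c then 1 else 0) + 2 * R9 l k

theorem R9_snoc (l : List ℕ) (c k : ℕ) : R9 (l ++ [c]) k = R9 l k + 2 ^ l.length * (if k = c then 1 else 0) := by
  induction l with
  | nil => simp [R9]
  | cons d l ih => simp only [List.cons_append, R9, ih, List.length_cons, pow_succ]; ring

theorem E9_R9 {n : ℕ} (l : List ℕ) (z : Fin n → ℕ) (k : Fin n) :
    E9 l z k + R9 l ((k : ℕ) + 1) = 2 ^ l.length - 1 + 2 ^ l.length * z k := by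
  induction l with
  | nil => simp [E9, R9]
  | cons c l ih =>
    simp only [E9, R9, List.length_cons]
    have : 0 < 2 ^ l.length := by positivity
    have h2 : 2 ^ (l.length + 1) * z k = 2 * (2 ^ l.length * z k) := by rw [pow_succ]; ring
    rw [h2, pow_succ]
    split_ifs <;> omega

theorem G9_eq (I : List ℕ) (k : ℕ) :
    ∑ t ∈ Finset.range I.length, (if I.getD t 0 = k then 2 ^ (I.length - 1 - t) else 0) = R9 I.reverse k := by
  induction I with
  | nil => simp [R9]
  | cons c I ih =>
    rw [List.length_cons, Finset.sum_range_succ', List.reverse_cons, R9_snoc, ← ih]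
    congr 1
    · refine Finset.sum_congr rfl fun t ht => ?_
      have := Finset.mem_range.mp ht
      rw [List.getD_cons_succ]
      congr 2; omega
    · simp only [List.getD_cons_zero, List.length_reverse, eq_comm (a := c)]
      split_ifs <;> simp

theorem xIu9 (n : ℕ) (I : List ℕ) (hI : I ≠ []) (k : Fin n) :
    xIuExp n I 1 k = R9 I.reverse ((k : ℕ) + 1) := by
  rw [← G9_eq]
  unfold xIuExp
  obtain ⟨c, l, rfl⟩ := List.exists_cons_of_ne_nil hI
  rw [List.length_cons, Finset.sum_range_succ', add_comm]
  congr 1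
  · rw [← Finset.Ico_add_one_right_eq_Icc, Finset.sum_Ico_eq_sum_range]
    refine Finset.sum_congr (by congr 1) fun t ht => ?_
    have h1 : 1 + 1 + t - 1 = t + 1 := by omega
    have h2 : l.length + 1 - (1 + 1 + t) = l.length + 1 - 1 - (t + 1) := by omega
    rw [h1, h2]
  · simp only [Nat.sub_self, Nat.add_sub_cancel, Nat.sub_zero]
    have : 2 ^ (l.length + 1) - 2 ^ l.length = 2 ^ l.length := by rw [pow_succ]; omega
    rw [this]

theorem fIdx9_inj (n i : ℕ) : Function.Injective (fIdx n i) := by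
  intro a b h
  unfold fIdx at h
  ext
  split_ifs at h <;> simp at h <;> omega

theorem mapDom9 (n i e : ℕ) (hi : 1 ≤ i ∧ i ≤ n) (k : Fin n) :
    Finsupp.mapDomain (fIdx n i) (Xexp (n - 1) e) k = if (k : ℕ) + 1 = i then 0 else e := by
  have hk := k.isLt
  split_ifs with h
  · apply Finsupp.mapDomain_of_notMem_range
    rintro ⟨j, hj⟩
    unfold fIdx at hj
    have := congrArg Fin.val hj
    split_ifs at this <;> simp at this <;> omega
  · obtain ⟨j, rfl⟩ : ∃ j, fIdx n i j = k := by
      by_cases hlt : (k : ℕ) + 1 < i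
      · refine ⟨⟨k, by omega⟩, ?_⟩
        unfold fIdx; ext; simp [hlt]
      · refine ⟨⟨k - 1, by omega⟩, ?_⟩
        unfold fIdx; ext; simp only
        rw [if_neg (by omega)]; simp; omega
    rw [Finsupp.mapDomain_apply (fIdx9_inj n i)]; rfl

theorem nuE9 (n e k : ℕ) (hk : 2 ≤ k ∧ k ≤ n) : nuE (Xexp (n - 1) e) (k - 1) = e := by
  unfold nuE
  rw [dif_pos (by omega)]; rfl

theorem compat9 (n ℓ : ℕ) (I : List ℕ) (hI : I ≠ []) (hr : ∀ c ∈ I, 2 ≤ c ∧ c ≤ n)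
    (hl : I.length < ℓ) (u : ℕ) : uCompat I u (Xexp (n - 1) (2 ^ ℓ - 1)) ↔ u = 1 := by
  have hpos : 0 < I.length := List.length_pos_of_ne_nil hI
  have hnu : ∀ t < I.length, nuE (Xexp (n - 1) (2 ^ ℓ - 1)) (I.getD t 0 - 1) = 2 ^ ℓ - 1 := by
    intro t ht
    apply nuE9
    rw [List.getD_eq_getElem _ _ ht]
    exact hr _ (List.getElem_mem ht)
  have hlt : 2 ^ I.length < 2 ^ ℓ := Nat.pow_lt_pow_right (by norm_num) hl
  have hp0 : 0 < 2 ^ I.length := by positivity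
  unfold uCompat
  rw [if_neg hI]
  constructor
  · rintro ⟨h1, h2, h3, -⟩
    by_contra hne
    have := h3 1 le_rfl (by omega)
    rw [hnu _ (by omega)] at this
    omega
  · rintro rfl
    refine ⟨le_rfl, by omega, fun t h1 h2 => by omega, ?_, ?_, ?_⟩
    · rw [hnu _ (by omega)]; omega
    · intro t h1 h2
      rw [hnu _ (by omega), Nat.testBit_two_pow_sub_one]; simp; omega
    · intro t h1 h2
      rw [hnu _ (by omega), Nat.testBit_two_pow_sub_one]; simp; omega

theorem phi9 (n ℓ i u : ℕ) (I : List ℕ) (hI : I ≠ []) (hr : ∀ c ∈ I, 2 ≤ c ∧ c ≤ n)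
    (hl : I.length < ℓ) (hi : 1 ≤ i ∧ i ≤ n) (hiI : i ∉ I) (hiu : i ≠ u) :
    phiMon n i I (Xexp (n - 1) (2 ^ ℓ - 1)) * xvMon n u (2 ^ ℓ)
      = mon9 (E9 (I.reverse ++ List.replicate (ℓ - I.length) i) (unit9 n u)) := by
  have hex : ∃ v, uCompat I v (Xexp (n - 1) (2 ^ ℓ - 1)) := ⟨1, (compat9 n ℓ I hI hr hl 1).mpr rfl⟩
  have hch : Classical.choose hex = 1 := (compat9 n ℓ I hI hr hl _).mp (Classical.choose_spec hex)
  have h2 : xvMon n u (2 ^ ℓ) = mon9 (fun k : Fin n => if (k : ℕ) + 1 = u then 2 ^ ℓ else 0) := rfl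
  unfold phiMon
  rw [dif_pos hex, hch, h2]
  change mon9 _ * mon9 _ = _
  rw [mon9_mul]
  congr 1
  funext k
  rw [Pi.add_apply, mapDom9 n i _ hi, xIu9 n I hI, E9_append]
  have h3 := E9_R9 I.reverse (E9 (List.replicate (ℓ - I.length) i) (unit9 n u)) k
  have h4 := E9_R9 I.reverse (fun _ => 0) k
  rw [E9_rep] at h3
  rw [List.length_reverse] at h3 h4
  have hpw : 2 ^ ℓ = 2 ^ I.length * 2 ^ (ℓ - I.length) := by rw [← pow_add]; congr 1; omega
  have hp0 : 0 < 2 ^ I.length := by positivity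
  have hp1 : 0 < 2 ^ (ℓ - I.length) := by positivity
  have hle : 2 ^ I.length ≤ 2 ^ ℓ := Nat.pow_le_pow_right (by norm_num) hl.le
  have hR : (k : ℕ) + 1 = i → R9 I.reverse ((k : ℕ) + 1) = 0 := by
    intro h
    rw [h, ← G9_eq]
    refine Finset.sum_eq_zero fun t ht => ?_
    have := Finset.mem_range.mp ht
    rw [if_neg]
    rw [List.getD_eq_getElem _ _ this]
    intro h'; exact hiI (h' ▸ List.getElem_mem this)
  unfold unit9 at h3 ⊢
  by_cases hk : (k : ℕ) + 1 = i
  · have hku : ¬ ((k : ℕ) + 1 = u) := by omega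
    have := hR hk
    simp only [if_pos hk, if_neg hku] at h3 ⊢
    simp only [mul_zero, add_zero] at h3 h4 ⊢
    omega
  · simp only [if_neg hk] at h3 ⊢
    have e1 : 2 ^ I.length * (2 ^ (ℓ - I.length) - 1 + 2 ^ (ℓ - I.length) * (if (k : ℕ) + 1 = u then 1 else 0))
      = 2 ^ ℓ - 2 ^ I.length + (if (k : ℕ) + 1 = u then 2 ^ ℓ else 0) := by
      rw [mul_add, Nat.mul_sub, ← hpw, ← mul_assoc, ← hpw, mul_one]
      split_ifs <;> simp
    rw [e1] at h3
    omega

theorem term9 {n ℓ : ℕ} (hl2 : ℓ ≤ n) (u i : ℕ) (S : Finset ℕ)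
    (hu : u ∈ Finset.Icc ℓ n) (hi : i ∈ Finset.Icc 1 (ℓ - 1))
    (hS : S ∈ (Finset.Icc (i + 1) (ℓ - 1)).powerset) :
    q9 n ℓ (phiMon n i ((insert u S).sort (· ≤ ·)) (Xexp (n - 1) (2 ^ ℓ - 1)) * xvMon n u (2 ^ ℓ))
      = W9 n ℓ (K9 ℓ (insert i S) u) u := by
  simp only [Finset.mem_Icc, Finset.mem_powerset] at hu hi hS
  have hS' : ∀ c ∈ S, i + 1 ≤ c ∧ c ≤ ℓ - 1 := fun c hc => Finset.mem_Icc.mp (hS hc)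
  have huS : u ∉ S := fun h => by have := hS' u h; omega
  have hiS : i ∉ S := fun h => by have := hS' i h; omega
  have hcard : S.card ≤ ℓ - 1 - i := by
    have := Finset.card_le_card hS
    simp at this; omega
  have hlen : ((insert u S).sort (· ≤ ·)).length = S.card + 1 := by
    rw [Finset.length_sort, Finset.card_insert_of_notMem huS]
  have hSR : InR9 n S.toList := fun c hc => by have := hS' c (by simpa using hc); omega
  rw [phi9 n ℓ i u]
  · rw [hlen]
    have hp : (((insert u S).sort (· ≤ ·)).reverse ++ List.replicate (ℓ - (S.card + 1)) i).Perm
        (List.replicate (ℓ - (S.card + 1)) i ++ u :: S.toList) := by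
      refine List.perm_append_comm.trans (List.Perm.append_left _ ?_)
      refine (List.reverse_perm _).trans ?_
      refine (Finset.sort_perm_toList _ _).trans (Finset.toList_insert huS)
    have hp2 : (List.replicate (ℓ - (S.card + 1)) u ++ i :: S.toList).Perm (K9 ℓ (insert i S) u) := by
      unfold K9
      rw [Finset.card_insert_of_notMem hiS]
      refine List.perm_append_comm.trans (List.Perm.append_right _ ?_)
      exact (Finset.toList_insert hiS).symm
    have hR1 : InR9 n (List.replicate (ℓ - (S.card + 1)) i ++ u :: S.toList) :=
      InR9_append.mpr ⟨InR9_rep (by omega), InR9_cons.mpr ⟨by omega, hSR⟩⟩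
    have hR2 : InR9 n (List.replicate (ℓ - (S.card + 1)) u ++ i :: S.toList) :=
      InR9_append.mpr ⟨InR9_rep (by omega), InR9_cons.mpr ⟨by omega, hSR⟩⟩
    have e1 := perm9 (ℓ := ℓ) u (by omega) hp [] (by simp [InR9])
      (fun c hc => hR1 c (hp.mem_iff.mp hc)) (by rw [hp.length_eq]; simp; omega)
    have e2 := perm9 (ℓ := ℓ) u (by omega) hp2 [] (by simp [InR9]) hR2 (by simp; omega)
    have e3 := relS9 (n := n) (ℓ := ℓ) [] S.toList (by simp [InR9]) hSR (ℓ - (S.card + 1)) (by omega) i u u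
      (by omega) (by omega) (by omega) (by simp; omega)
    exact e1.trans (e3.trans e2)
  · intro h; rw [h] at hlen; simp at hlen
  · intro c hc
    rw [Finset.mem_sort, Finset.mem_insert] at hc
    rcases hc with rfl | hc
    · omega
    · have := hS' c hc; omega
  · rw [hlen]; omega
  · omega
  · rw [Finset.mem_sort, Finset.mem_insert]
    rintro (h | h)
    · omega
    · exact hiS h
  · omega

/-- Proposition 3.8: for `1 ≤ ℓ ≤ n`,
`X_ℓ^{2^ℓ−1} x_ℓ^{2^ℓ} + Σ_{u=ℓ}^{n} Σ_{(i;I)∈N_{ℓ−1}} φ_{(i;I∪u)}(X^{2^ℓ−1}) x_u^{2^ℓ}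
+ Σ_{u=ℓ+1}^{n} X_u^{2^ℓ−1} x_u^{2^ℓ} ∈ A_ℓ^+P_n + P_n^−(ω)` where
`ω = ((n−1)^{(ℓ)}, 1)`.  A pair `(i;I) ∈ N_{ℓ−1}` is encoded as `1 ≤ i ≤ ℓ−1` together
with a finite set `S ⊆ {i+1, …, ℓ−1}` (whose increasing enumeration is `I`). -/
theorem statement9 (n ℓ : ℕ) (hn : 1 ≤ n) (hl1 : 1 ≤ ℓ) (hl2 : ℓ ≤ n) :
    XjMon n ℓ (2 ^ ℓ - 1) * xvMon n ℓ (2 ^ ℓ)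
    + (∑ u ∈ Finset.Icc ℓ n, ∑ i ∈ Finset.Icc 1 (ℓ - 1),
        ∑ S ∈ (Finset.Icc (i + 1) (ℓ - 1)).powerset,
          phiMon n i ((insert u S).sort (· ≤ ·)) (Xexp (n - 1) (2 ^ ℓ - 1))
            * xvMon n u (2 ^ ℓ))
    + ∑ u ∈ Finset.Icc (ℓ + 1) n, XjMon n u (2 ^ ℓ - 1) * xvMon n u (2 ^ ℓ)
    ∈ AplusS n ℓ ⊔ PnLt n ((n - 1) * (2 ^ ℓ - 1) + 2 ^ ℓ) (wSpike n ℓ) := by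
  change _ ∈ N9 n ℓ
  rw [← q9_zero, map_add, map_add]
  have hs := sumK9 (n := n) (ℓ := ℓ) hl1 hl2
  have h1 : ∀ u ∈ Finset.Icc ℓ n, ∑ K ∈ (Finset.Icc 1 (ℓ - 1)).powerset, W9 n ℓ (K9 ℓ K u) u
      = q9 n ℓ (XjMon n u (2 ^ ℓ - 1) * xvMon n u (2 ^ ℓ)) +
        q9 n ℓ (∑ i ∈ Finset.Icc 1 (ℓ - 1), ∑ S ∈ (Finset.Icc (i + 1) (ℓ - 1)).powerset,
          phiMon n i ((insert u S).sort (· ≤ ·)) (Xexp (n - 1) (2 ^ ℓ - 1))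
            * xvMon n u (2 ^ ℓ)) := by
    intro u hu
    rw [pow_split9 (ℓ - 1) _ _ 1 rfl]
    congr 1
    · rw [Xj_mul9]; simp [W9, K9]
    · rw [map_sum]
      refine Finset.sum_congr rfl fun i hi => ?_
      rw [map_sum]
      refine Finset.sum_congr rfl fun S hS => ?_
      exact (term9 hl2 u i S hu hi hS).symm
  rw [Finset.sum_congr rfl h1, Finset.sum_add_distrib] at hs
  have hI : Finset.Icc ℓ n = insert ℓ (Finset.Icc (ℓ + 1) n) := by
    ext x; simp only [Finset.mem_Icc, Finset.mem_insert]; omega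
  rw [← map_sum, ← map_sum] at hs
  nth_rewrite 1 [hI] at hs
  rw [Finset.sum_insert (by simp), map_add] at hs
  rw [← hs]
  abel
end
end

section
/- Let n ≥ 2 and 2 ≤ d ≤ n, and let ω be the weight vector with ω_i = n−1 for 1 ≤ i ≤ d, ω_{d+1} = 1, and ω_i = 0 for i > d+1. Then Σ_{u=1}^{d−1} X_u^{2^d−1} x_u^{2^d} + Σ_{u=d}^{n} Σ_{(i;I)∈N_{d−1}} φ_{(i;I∪u)}(X^{2^d−1}) x_u^{2^d} ∈ A_d^+P_n + P_n^−(ω). -/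
open MvPolynomial

noncomputable section

lemma ev_apply' {n : ℕ} (v : Fin n → ℕ) (k : Fin n) : ev v k = v k := rfl

lemma choose_odd_bit (b : ℕ) : ∀ a p : ℕ, Nat.choose a p % 2 = 1 → p / 2 ^ b % 2 = 1 →
    a / 2 ^ b % 2 = 1 := by
  have key : ∀ a p : ℕ, Nat.choose a p % 2 = 1 →
      Nat.choose (a % 2) (p % 2) % 2 = 1 ∧ Nat.choose (a / 2) (p / 2) % 2 = 1 := by
    intro a p h
    have : Fact (Nat.Prime 2) := ⟨Nat.prime_two⟩
    have h1 := Choose.choose_modEq_choose_mod_mul_choose_div_nat (n := a) (k := p) (p := 2)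
    unfold Nat.ModEq at h1
    rw [h, Nat.mul_mod] at h1
    have h2 := Nat.mod_two_eq_zero_or_one ((a % 2).choose (p % 2))
    have h3 := Nat.mod_two_eq_zero_or_one ((a / 2).choose (p / 2))
    rcases h2 with h2 | h2 <;> rcases h3 with h3 | h3 <;> simp [h2, h3] at h1 ⊢
  induction b with
  | zero =>
    intro a p h hp
    have := (key a p h).1
    simp only [pow_zero, Nat.div_one] at hp ⊢
    rcases Nat.mod_two_eq_zero_or_one a with ha | ha
    · rw [ha, hp] at this; simp at this
    · exact ha
  | succ b ih =>
    intro a p h hp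
    have := (key a p h).2
    rw [pow_succ', ← Nat.div_div_eq_div_mul] at hp ⊢
    exact ih _ _ this hp

lemma bit_add_low (a p i : ℕ) (h : 2 ^ (i + 1) ∣ p) : (a + p) / 2 ^ i % 2 = a / 2 ^ i % 2 := by
  obtain ⟨c, rfl⟩ := h
  have : a + 2 ^ (i + 1) * c = a + 2 ^ i * (2 * c) := by ring
  rw [this, Nat.add_mul_div_left _ _ (by positivity)]
  omega

lemma bit_add_at (a p i : ℕ) (h : 2 ^ i ∣ p) :
    (a + p) / 2 ^ i = a / 2 ^ i + p / 2 ^ i := by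
  obtain ⟨c, rfl⟩ := h
  rw [Nat.add_mul_div_left _ _ (by positivity), Nat.mul_div_cancel_left _ (by positivity)]

lemma lex_term {n : ℕ} (a p : Fin n →₀ ℕ) (s : ℕ) (hsum : ∑ j, p j = 2 ^ s)
    (hns : ∀ j, p ≠ Finsupp.single j (2 ^ s))
    (hodd : ∀ j, Nat.choose (a j) (p j) % 2 = 1) :
    ∃ b, b < s ∧ (∀ i, i < b → wt (a + p) i = wt a i) ∧ wt (a + p) b < wt a b := by
  classical
  have hpos : ∃ j, p j ≠ 0 := by
    by_contra! h
    simp only [h, Finset.sum_const_zero] at hsum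
    have : 0 < 2 ^ s := by positivity
    omega
  obtain ⟨j0, hj0⟩ := hpos
  have hex : ∃ b, ¬ ∀ j, 2 ^ (b + 1) ∣ p j := by
    refine ⟨p j0, fun h => ?_⟩
    have := Nat.le_of_dvd (Nat.pos_of_ne_zero hj0) (h j0)
    have h2 : p j0 + 1 < 2 ^ (p j0 + 1) := Nat.lt_two_pow_self
    omega
  set b := Nat.find hex with hb
  have hbs := Nat.find_spec hex
  rw [← hb] at hbs
  have hlow : ∀ i, i < b → ∀ j, 2 ^ (i + 1) ∣ p j := by
    intro i hi
    have := Nat.find_min hex hi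
    push Not at this
    exact this
  have hdiv : ∀ j, 2 ^ b ∣ p j := by
    intro j
    rcases Nat.eq_zero_or_pos b with h0 | h0
    · simp [h0]
    · have := hlow (b - 1) (by omega) j
      rwa [Nat.sub_add_cancel h0] at this
  have hbs' : b < s := by
    by_contra hcon
    push Not at hcon
    have hd : ∀ j, 2 ^ s ∣ p j := fun j => (pow_dvd_pow 2 hcon).trans (hdiv j)
    apply hns j0
    have h1 : 2 ^ s ≤ p j0 := Nat.le_of_dvd (Nat.pos_of_ne_zero hj0) (hd j0)
    have h2 := Finset.add_sum_erase Finset.univ p (Finset.mem_univ j0)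
    rw [hsum] at h2
    have h3 : ∑ x ∈ Finset.univ.erase j0, p x = 0 := by omega
    rw [Finset.sum_eq_zero_iff] at h3
    ext k
    by_cases hk : k = j0
    · subst hk; simp; omega
    · rw [Finsupp.single_apply, if_neg (Ne.symm hk)]
      exact h3 k (by simp [hk])
  refine ⟨b, hbs', ?_, ?_⟩
  · intro i hi
    unfold wt
    exact Finset.sum_congr rfl fun j _ => bit_add_low _ _ _ (hlow i hi j)
  · unfold wt
    push Not at hbs
    obtain ⟨j1, hj1⟩ := hbs
    have hcase : ∀ j, p j / 2 ^ b % 2 = 1 →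
        (a + p) j / 2 ^ b % 2 < a j / 2 ^ b % 2 := by
      intro j hj
      have := choose_odd_bit b _ _ (hodd j) hj
      rw [Finsupp.add_apply, bit_add_at _ _ _ (hdiv j)]
      omega
    apply Finset.sum_lt_sum
    · intro j _
      rcases Nat.mod_two_eq_zero_or_one (p j / 2 ^ b) with h | h
      · rw [Finsupp.add_apply, bit_add_at _ _ _ (hdiv j)]
        omega
      · exact (hcase j h).le
    · refine ⟨j1, Finset.mem_univ _, hcase j1 ?_⟩
      by_contra h
      apply hj1
      obtain ⟨c, hc⟩ := hdiv j1
      rw [hc, Nat.mul_div_cancel_left _ (by positivity)] at h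
      rw [hc, pow_succ]
      exact Nat.mul_dvd_mul_left _ (by omega)

lemma sqTot_monomial {n : ℕ} (a : Fin n →₀ ℕ) :
    sqTot n (monomial a 1) = ∑ p ∈ Fintype.piFinset (fun j => Finset.range (a j + 1)),
      monomial (a + ev p) ((∏ j, (Nat.choose (a j) (p j)) : ℕ) : ZMod 2) := by
  classical
  have h1 : sqTot n (monomial a 1) = ∏ j, (X j + X j ^ 2 : P n) ^ (a j) := by
    unfold sqTot
    rw [bind₁_monomial]
    simp only [map_one, one_mul]
    exact Finset.prod_subset (Finset.subset_univ _) (fun j _ hj => by simp at hj; simp [hj])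
  rw [h1]
  have h2 : ∀ j, (X j + X j ^ 2 : P n) ^ (a j) =
      ∑ k ∈ Finset.range (a j + 1), (C ((Nat.choose (a j) k : ℕ) : ZMod 2) * X j ^ (a j + k)) := by
    intro j
    have : (X j + X j ^ 2 : P n) = X j * (X j + 1) := by ring
    rw [this, mul_pow, add_pow, Finset.mul_sum]
    refine Finset.sum_congr rfl fun k _ => ?_
    simp
    ring
  rw [Finset.prod_congr rfl (fun j _ => h2 j), Finset.prod_univ_sum]
  refine Finset.sum_congr rfl fun p _ => ?_
  rw [Finset.prod_mul_distrib, ← map_prod, monomial_eq]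
  push_cast
  congr 1
  rw [Finsupp.prod_fintype _ _ (by simp)]
  rfl

lemma SqK_monomial {n : ℕ} (k : ℕ) (a : Fin n →₀ ℕ) :
    SqK n k (monomial a 1) = homogeneousComponent (mdeg a + k) (sqTot n (monomial a 1)) := by
  have hd : a.degree = mdeg a := by
    rw [Finsupp.degree_eq_sum]; rfl
  have ht : (monomial a (1 : ZMod 2) : P n).totalDegree = mdeg a := by
    rw [totalDegree_monomial _ one_ne_zero, ← hd]; rfl
  have hh : (monomial a (1 : ZMod 2) : P n).IsHomogeneous (mdeg a) :=
    isHomogeneous_monomial _ hd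
  unfold SqK
  rw [ht, Finset.sum_eq_single (mdeg a)]
  · rw [homogeneousComponent_of_mem hh, if_pos rfl]
  · intro d _ hne
    rw [homogeneousComponent_of_mem hh, if_neg hne]
    simp
  · simp

lemma mdeg_add {n : ℕ} (a b : Fin n →₀ ℕ) : mdeg (a + b) = mdeg a + mdeg b := by
  simp [mdeg, Finset.sum_add_distrib]

lemma main_rel {n d D s : ℕ} (w : ℕ → ℕ) (hs : s < d) (a : Fin n →₀ ℕ)
    (hD : mdeg a + 2 ^ s = D) (hw : ∀ i, i < s → wt a i = w i)
    (hbit : ∀ j, a j / 2 ^ s % 2 = 1) :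
    (∑ j, monomial (a + Finsupp.single j (2 ^ s)) 1 : P n) ∈ AplusS n d ⊔ PnLt n D w := by
  classical
  have hge : ∀ j, 2 ^ s ≤ a j := by
    intro j
    by_contra h
    have := hbit j
    rw [Nat.div_eq_of_lt (by omega)] at this
    omega
  have h1 : SqK n (2 ^ s) (monomial a 1) ∈ AplusS n d :=
    Submodule.subset_span ⟨2 ^ s, Nat.one_le_two_pow, Nat.pow_lt_pow_right (by norm_num) hs, _, rfl⟩
  rw [SqK_monomial, sqTot_monomial, map_sum] at h1
  set T := Fintype.piFinset (fun j => Finset.range (a j + 1)) with hT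
  set f : (Fin n → ℕ) → P n := fun p => homogeneousComponent (mdeg a + 2 ^ s)
    (monomial (a + ev p) ((∏ j, (Nat.choose (a j) (p j)) : ℕ) : ZMod 2)) with hf
  set S : Finset (Fin n → ℕ) := Finset.univ.image (fun j : Fin n => (⇑(Finsupp.single j (2 ^ s)) : Fin n → ℕ)) with hS
  have hST : S ⊆ T := by
    intro p hp
    simp only [hS, Finset.mem_image, Finset.mem_univ, true_and] at hp
    obtain ⟨j, rfl⟩ := hp
    simp only [hT, Fintype.mem_piFinset, Finset.mem_range]
    intro k
    have := hge k
    rw [Finsupp.single_apply]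
    split_ifs <;> omega
  have hsplit : ∑ p ∈ T \ S, f p + ∑ p ∈ S, f p = ∑ p ∈ T, f p := Finset.sum_sdiff hST
  have hev : ∀ p : Fin n →₀ ℕ, ev (⇑p) = p := fun p => by ext; rfl
  have hSsum : ∑ p ∈ S, f p = ∑ j, monomial (a + Finsupp.single j (2 ^ s)) 1 := by
    rw [hS, Finset.sum_image]
    · refine Finset.sum_congr rfl fun j _ => ?_
      simp only [hf]
      have hc : ((∏ k, Nat.choose (a k) ((Finsupp.single j (2 ^ s) : Fin n →₀ ℕ) k) : ℕ) : ZMod 2) = 1 := by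
        push_cast
        rw [Finset.prod_eq_single j]
        · simp only [Finsupp.single_eq_same]
          have : Fact (Nat.Prime 2) := ⟨Nat.prime_two⟩
          have h2 : ∀ t x : ℕ, Nat.choose x (2 ^ t) % 2 = x / 2 ^ t % 2 := by
            intro t
            induction t with
            | zero => intro x; simp
            | succ t ih =>
              intro x
              have h1 := Choose.choose_modEq_choose_mod_mul_choose_div_nat (n := x) (k := 2 ^ (t+1)) (p := 2)
              unfold Nat.ModEq at h1
              rw [h1]
              have e1 : 2 ^ (t + 1) % 2 = 0 := by rw [pow_succ]; simp
              have e2 : 2 ^ (t + 1) / 2 = 2 ^ t := by rw [pow_succ]; simp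
              rw [e1, e2, Nat.choose_zero_right, one_mul, ih, Nat.div_div_eq_div_mul, pow_succ']
          have h3 := h2 s (a j)
          rw [hbit j] at h3
          rw [← Nat.cast_one, ZMod.natCast_eq_natCast_iff]
          exact h3
        · intro k _ hk
          rw [Finsupp.single_apply, if_neg (Ne.symm hk)]; simp
        · simp
      rw [hc, hev, homogeneousComponent_of_mem (isHomogeneous_monomial _ (n := mdeg a + 2 ^ s) ?_), if_pos rfl]
      rw [map_add, Finsupp.degree_single]
      congr 1
      rw [Finsupp.degree_eq_sum]; rfl
    · intro x _ y _ hxy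
      have := congrFun hxy x
      simp only [Finsupp.single_eq_same] at this
      by_contra hne
      rw [Finsupp.single_apply, if_neg (Ne.symm hne)] at this
      have : 0 < 2 ^ s := by positivity
      omega
  have hlow : ∑ p ∈ T \ S, f p ∈ PnLt n D w := by
    refine Submodule.sum_mem _ fun p hp => ?_
    simp only [Finset.mem_sdiff] at hp
    obtain ⟨-, hpS⟩ := hp
    have hhom : (monomial (a + ev p) ((∏ j, (Nat.choose (a j) (p j)) : ℕ) : ZMod 2) : P n).IsHomogeneous
        (mdeg (a + ev p)) := isHomogeneous_monomial _ (by rw [Finsupp.degree_eq_sum]; rfl)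
    simp only [hf]
    rw [homogeneousComponent_of_mem hhom]
    split_ifs with hdeg
    swap
    · exact Submodule.zero_mem _
    by_cases hodd : (∏ j, (Nat.choose (a j) (p j))) % 2 = 1
    swap
    · have : (((∏ j, (Nat.choose (a j) (p j))) : ℕ) : ZMod 2) = 0 := by
        rw [← Nat.cast_zero, ZMod.natCast_eq_natCast_iff]
        unfold Nat.ModEq; omega
      rw [this, monomial_zero]; exact Submodule.zero_mem _
    have hodd' : ∀ j, Nat.choose (a j) (p j) % 2 = 1 := by
      intro j
      by_contra hcon
      have hd2 : 2 ∣ Nat.choose (a j) (p j) := by omega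
      have := hd2.trans (Finset.dvd_prod_of_mem (fun j => Nat.choose (a j) (p j)) (Finset.mem_univ j))
      omega
    have hone : (((∏ j, (Nat.choose (a j) (p j))) : ℕ) : ZMod 2) = 1 := by
      rw [← Nat.cast_one, ZMod.natCast_eq_natCast_iff]; exact hodd
    rw [hone]
    rw [mdeg_add] at hdeg
    obtain ⟨b, hb, hb1, hb2⟩ := lex_term a (ev p) s (by unfold mdeg at hdeg; omega) (by
      intro j hj
      apply hpS
      rw [hS, Finset.mem_image]
      exact ⟨j, Finset.mem_univ _, by rw [← hj]; rfl⟩) hodd'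
    refine Submodule.subset_span ⟨a + ev p, by rw [mdeg_add]; omega, ⟨b, ?_, ?_⟩, rfl⟩
    · intro i hi
      rw [hb1 i hi, hw i (by omega)]
    · rw [← hw b hb]; exact hb2
  rw [← hSsum]
  have : ∑ p ∈ S, f p = ∑ p ∈ T, f p - ∑ p ∈ T \ S, f p := by rw [← hsplit]; abel
  rw [this]
  exact Submodule.sub_mem _ (Submodule.mem_sup_left h1) (Submodule.mem_sup_right hlow)

def Bz : List ℕ → ℕ → ℕ
  | [], _ => 0
  | m :: l, k => (if m = k + 1 then 0 else 1) + 2 * Bz l k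

def EE (n : ℕ) (l : List ℕ) (u : ℕ) : Fin n →₀ ℕ :=
  ev fun k => Bz l k + 2 ^ l.length * (if (k : ℕ) + 1 = u then 1 else 0)

lemma Bz_append (p l : List ℕ) (k : ℕ) : Bz (p ++ l) k = Bz p k + 2 ^ p.length * Bz l k := by
  induction p with
  | nil => simp [Bz]
  | cons m p ih => simp only [List.cons_append, Bz, ih, List.length_cons]; ring

lemma Bz_replicate (L j k : ℕ) : Bz (List.replicate L j) k = if j = k + 1 then 0 else 2 ^ L - 1 := by
  induction L with
  | zero => simp [Bz]
  | succ L ih =>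
    simp only [List.replicate_succ, Bz, ih]
    have := Nat.one_le_two_pow (n := L)
    split_ifs
    · rfl
    · rw [pow_succ]; omega

lemma bit_Bz (p : List ℕ) (k c : ℕ) : ∀ i, (hi : i < p.length) →
    (Bz p k + 2 ^ p.length * c) / 2 ^ i % 2 = if p[i] = k + 1 then 0 else 1 := by
  induction p with
  | nil => intro i hi; simp at hi
  | cons m p ih =>
    intro i hi
    have e : Bz (m :: p) k + 2 ^ (m :: p).length * c
        = (if m = k + 1 then 0 else 1) + 2 * (Bz p k + 2 ^ p.length * c) := by
      simp only [Bz, List.length_cons]; ring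
    rw [e]
    cases i with
    | zero => simp; split_ifs <;> omega
    | succ i =>
      simp only [List.getElem_cons_succ]
      rw [← ih i (by simpa using hi), pow_succ', ← Nat.div_div_eq_div_mul]
      congr 2
      split_ifs <;> omega

lemma sum_ne (n x : ℕ) (h1 : 1 ≤ x) (h2 : x ≤ n) :
    ∑ k : Fin n, (if x = (k : ℕ) + 1 then 0 else 1) = n - 1 := by
  have h : ∑ k : Fin n, (if x = (k : ℕ) + 1 then 0 else 1) + 1 = n := by
    have h3 : ∑ k : Fin n, (if x = (k : ℕ) + 1 then 1 else 0) = 1 := by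
      rw [Finset.sum_eq_single (⟨x - 1, by omega⟩ : Fin n)]
      · rw [if_pos]; simp only; omega
      · intro b _ hb
        rw [if_neg]
        intro h; apply hb; ext; simp only; omega
      · simp
    have h4 : ∑ k : Fin n, ((if x = (k : ℕ) + 1 then 0 else 1) +
        (if x = (k : ℕ) + 1 then 1 else 0)) = n := by
      rw [Finset.sum_congr rfl (g := fun _ => 1) (fun k _ => by split_ifs <;> rfl)]
      simp
    rw [Finset.sum_add_distrib, h3] at h4
    exact h4
  omega

def Good (n : ℕ) (l : List ℕ) : Prop := ∀ x ∈ l, 1 ≤ x ∧ x ≤ n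

lemma sum_bit_Bz (n : ℕ) (p : List ℕ) (hp : Good n p) (c : Fin n → ℕ) (i : ℕ) (hi : i < p.length) :
    ∑ k : Fin n, (Bz p k + 2 ^ p.length * c k) / 2 ^ i % 2 = n - 1 := by
  rw [Finset.sum_congr rfl fun (k : Fin n) _ => bit_Bz p k (c k) i hi]
  obtain ⟨h1, h2⟩ := hp _ (List.getElem_mem hi)
  exact sum_ne n _ h1 h2

lemma sum_Bz (n : ℕ) (l : List ℕ) (hl : Good n l) :
    ∑ k : Fin n, Bz l k = (n - 1) * (2 ^ l.length - 1) := by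
  induction l with
  | nil => simp [Bz]
  | cons m l ih =>
    simp only [Bz, Finset.sum_add_distrib, ← Finset.mul_sum]
    obtain ⟨h1, h2⟩ := hl m (by simp)
    rw [ih (fun x hx => hl x (by simp [hx])), sum_ne n m h1 h2, List.length_cons, pow_succ]
    have := Nat.one_le_two_pow (n := l.length)
    obtain ⟨t, ht⟩ := Nat.exists_eq_add_of_le this
    rw [ht]
    have e1 : 1 + t - 1 = t := by omega
    have e2 : (1 + t) * 2 - 1 = 1 + 2 * t := by omega
    rw [e1, e2]; ring

lemma mdeg_EE (n : ℕ) (l : List ℕ) (hl : Good n l) (u : ℕ) (h1 : 1 ≤ u) (h2 : u ≤ n) :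
    mdeg (EE n l u) = (n - 1) * (2 ^ l.length - 1) + 2 ^ l.length := by
  unfold mdeg EE
  simp only [ev_apply', Finset.sum_add_distrib, ← Finset.mul_sum, sum_Bz n l hl]
  congr 1
  rw [Finset.sum_eq_single (⟨u - 1, by omega⟩ : Fin n)]
  · simp; omega
  · intro b _ hb
    rw [if_neg]
    intro h; apply hb; ext; simp; omega
  · simp

abbrev MM (n d : ℕ) : Submodule (ZMod 2) (P n) :=
  AplusS n d ⊔ PnLt n ((n - 1) * (2 ^ d - 1) + 2 ^ d) (wSpike n d)

def FF (n d u : ℕ) (l : List ℕ) : P n ⧸ MM n d := (MM n d).mkQ (monomial (EE n l u) 1)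

lemma FF_char2 {n d : ℕ} (x : P n ⧸ MM n d) : x + x = 0 := by
  rw [← two_smul (ZMod 2) x]
  have : (2 : ZMod 2) = 0 := rfl
  rw [this, zero_smul]

lemma FF_eq_of_add {n d : ℕ} {x y : P n ⧸ MM n d} (h : x + y = 0) : x = y := by
  have := FF_char2 y
  rw [← this] at h
  exact add_right_cancel h

lemma Good_append {n : ℕ} {p q : List ℕ} : Good n (p ++ q) ↔ Good n p ∧ Good n q := by
  unfold Good
  simp only [List.mem_append]
  exact ⟨fun h => ⟨fun x hx => h x (Or.inl hx), fun x hx => h x (Or.inr hx)⟩,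
    fun h x hx => hx.elim (h.1 x) (h.2 x)⟩

lemma Good_replicate {n L j : ℕ} (h : 1 ≤ j ∧ j ≤ n) : Good n (List.replicate L j) := by
  intro x hx
  rw [List.eq_of_mem_replicate hx]; exact h

lemma top_rel (n d : ℕ) (p : List ℕ) (hp : Good n p) (hl : p.length + 1 = d) (hn : 1 ≤ n) :
    ∑ j ∈ Finset.Icc 1 n, FF n d j (p ++ [j]) = 0 := by
  have hsum : ∑ j ∈ Finset.Icc 1 n, FF n d j (p ++ [j]) =
      ∑ j : Fin n, FF n d ((j : ℕ) + 1) (p ++ [(j : ℕ) + 1]) := by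
    rw [Fin.sum_univ_eq_sum_range (fun j => FF n d (j + 1) (p ++ [j + 1])) n]
    rw [Finset.range_eq_Ico, Finset.sum_Ico_add' (fun j => FF n d j (p ++ [j])) 0 n 1]
    rfl
  rw [hsum]
  set s := p.length with hs
  set A : Fin n →₀ ℕ := ev fun k => Bz p k + 2 ^ s * 1 with hA
  have hE : ∀ j : Fin n, A + Finsupp.single j (2 ^ s) = EE n (p ++ [(j : ℕ) + 1]) ((j : ℕ) + 1) := by
    intro j
    ext k
    simp only [hA, EE, Finsupp.add_apply, ev_apply', Bz_append, Bz, List.length_append, ← hs,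
      Finsupp.single_apply, Fin.ext_iff, List.length_singleton, pow_succ]
    split_ifs <;> omega
  have hm := main_rel (n := n) (d := d) (D := (n - 1) * (2 ^ d - 1) + 2 ^ d) (s := s) (wSpike n d)
    (by omega) A ?_ ?_ ?_
  · rw [← Submodule.Quotient.mk_eq_zero (MM n d)] at hm
    simp only [hE] at hm
    rw [← hm]
    simp only [FF, ← map_sum]
    rfl
  · have := mdeg_EE n (p ++ [1]) (Good_append.2 ⟨hp, by intro x hx; simp at hx; omega⟩) 1 le_rfl hn
    have h0 := hE ⟨0, by omega⟩
    simp only [zero_add] at h0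
    rw [← h0, mdeg_add] at this
    have h3 : mdeg (Finsupp.single (⟨0, by omega⟩ : Fin n) (2 ^ s)) = 2 ^ s := by
      unfold mdeg; rw [Finset.sum_eq_single (⟨0, by omega⟩ : Fin n)] <;> simp +contextual [Finsupp.single_apply, eq_comm]
    rw [h3] at this
    rw [this]
    simp [← hs, hl]
  · intro i hi
    unfold wt wSpike
    rw [if_pos (by omega)]
    exact sum_bit_Bz n p hp (fun _ => 1) i hi
  · intro j
    simp only [hA, ev_apply']
    rw [Nat.add_mul_div_left _ _ (by positivity), Nat.div_eq_of_lt]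
    have : ∀ (l : List ℕ) (k : ℕ), Bz l k < 2 ^ l.length := by
      intro l k
      induction l with
      | nil => simp [Bz]
      | cons m l ih => simp only [Bz, List.length_cons, pow_succ]; split_ifs <;> omega
    exact this p j

lemma Bz_lt (l : List ℕ) (k : ℕ) : Bz l k < 2 ^ l.length := by
  induction l with
  | nil => simp [Bz]
  | cons m l ih => simp only [Bz, List.length_cons, pow_succ]; split_ifs <;> omega

lemma mdeg_single {n : ℕ} (j : Fin n) (c : ℕ) : mdeg (Finsupp.single j c) = c := by
  unfold mdeg
  rw [Finset.sum_eq_single j] <;> simp +contextual [Finsupp.single_apply, eq_comm]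

lemma block_rel (n d u : ℕ) (hu1 : 1 ≤ u) (hu2 : u ≤ n) (p r : List ℕ) (a b L : ℕ) (hL : 1 ≤ L)
    (hlen : (p ++ (List.replicate L a ++ b :: r)).length = d)
    (hg : Good n (p ++ (List.replicate L a ++ b :: r))) (hab : a ≠ b) :
    FF n d u (p ++ (List.replicate L a ++ b :: r)) =
      FF n d u (p ++ (List.replicate L b ++ a :: r)) := by
  have hp : Good n p := (Good_append.1 hg).1
  have ha : 1 ≤ a ∧ a ≤ n := hg a (by
    obtain ⟨L, rfl⟩ := Nat.exists_eq_add_of_le' hL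
    simp [List.replicate_succ])
  have hb : 1 ≤ b ∧ b ≤ n := hg b (by simp)
  set s := p.length with hs
  set H : Fin n → ℕ := fun k => Bz r k + 2 ^ r.length * (if (k : ℕ) + 1 = u then 1 else 0) with hH
  set G : Fin n → ℕ := fun k => (if (k : ℕ) + 1 = a ∨ (k : ℕ) + 1 = b then 0 else 1) with hG
  set A : Fin n →₀ ℕ := ev fun k => Bz p k + 2 ^ s * ((2 ^ L - 1) + 2 ^ L * (G k + 2 * H k)) with hA
  have h2L := Nat.one_le_two_pow (n := L)
  have hd : d = s + L + 1 + r.length := by rw [← hlen]; simp; omega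
  have hEg : ∀ j k : Fin n, (A + Finsupp.single j (2 ^ s) : Fin n →₀ ℕ) k =
      Bz (p ++ List.replicate L ((j : ℕ) + 1)) k +
        2 ^ (p ++ List.replicate L ((j : ℕ) + 1)).length * (G k + (if k = j then 1 else 0) + 2 * H k) := by
    intro j k
    simp only [hA, Finsupp.add_apply, ev_apply', Bz_append, Bz_replicate, Finsupp.single_apply,
      List.length_append, List.length_replicate, ← hs, pow_add]
    obtain ⟨t, ht⟩ := Nat.exists_eq_add_of_le h2L
    rw [ht]
    by_cases hjk : j = k
    · subst hjk; simp; ring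
    · have h1 : k ≠ j := fun h => hjk h.symm
      have h2 : ¬ ((j : ℕ) + 1 = (k : ℕ) + 1) := fun h => hjk (Fin.ext (by omega))
      rw [if_neg hjk, if_neg h1, if_neg h2]
      ring
  have hE : ∀ (j : Fin n) (x y : ℕ), (j : ℕ) + 1 = x → ((x = a ∧ y = b) ∨ (x = b ∧ y = a)) →
      A + Finsupp.single j (2 ^ s) = EE n (p ++ (List.replicate L x ++ y :: r)) u := by
    intro j x y hx hxy
    subst hx
    ext k
    rw [hEg]
    have e : G k + (if k = j then 1 else 0) = if y = (k : ℕ) + 1 then 0 else 1 := by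
      simp only [hG, Fin.ext_iff]
      split_ifs <;> omega
    rw [e]
    simp only [EE, ev_apply', hH]
    rw [← List.append_assoc, Bz_append (p ++ _)]
    rw [List.length_append (as := p ++ _), pow_add]
    simp only [Bz, List.length_cons, pow_succ]
    ring
  have hlen2 : ∀ x y : ℕ, (p ++ (List.replicate L x ++ y :: r)).length = d := by
    intro x y; rw [← hlen]; simp
  have hm := main_rel (n := n) (d := d) (D := (n - 1) * (2 ^ d - 1) + 2 ^ d) (s := s) (wSpike n d)
    (by omega) A ?_ ?_ ?_
  · set ja : Fin n := ⟨a - 1, by omega⟩ with hja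
    set jb : Fin n := ⟨b - 1, by omega⟩ with hjb
    have hne : ja ≠ jb := by
      intro h; simp [hja, hjb] at h; omega
    rw [← Finset.add_sum_erase _ _ (Finset.mem_univ ja),
      ← Finset.add_sum_erase _ _ (Finset.mem_erase.2 ⟨hne.symm, Finset.mem_univ jb⟩),
      hE ja a b (by simp [hja]; omega) (Or.inl ⟨rfl, rfl⟩),
      hE jb b a (by simp [hjb]; omega) (Or.inr ⟨rfl, rfl⟩)] at hm
    have hrest : (∑ j ∈ (Finset.univ.erase ja).erase jb,
        monomial (A + Finsupp.single j (2 ^ s)) 1 : P n) ∈ MM n d := by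
      refine Submodule.sum_mem _ fun j hj => Submodule.mem_sup_right (Submodule.subset_span ?_)
      simp only [Finset.mem_erase, Finset.mem_univ, and_true] at hj
      have hja' : (j : ℕ) + 1 ≠ a := by
        intro h; apply hj.2; ext; simp [hja]; omega
      have hjb' : (j : ℕ) + 1 ≠ b := by
        intro h; apply hj.1; ext; simp [hjb]; omega
      have hgp : Good n (p ++ List.replicate L ((j : ℕ) + 1)) :=
        Good_append.2 ⟨hp, Good_replicate ⟨by omega, by omega⟩⟩
      have hlp : (p ++ List.replicate L ((j : ℕ) + 1)).length = s + L := by simp [hs]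
      refine ⟨A + Finsupp.single j (2 ^ s), ?_, ⟨s + L, ?_, ?_⟩, rfl⟩
      · have := mdeg_EE n _ hg u hu1 hu2
        rw [← hE ja a b (by simp [hja]; omega) (Or.inl ⟨rfl, rfl⟩), mdeg_add, mdeg_single, hlen] at this
        rw [mdeg_add, mdeg_single, this]
      · intro i hi
        unfold wt wSpike
        rw [if_pos (by omega), Finset.sum_congr rfl fun k _ => by rw [hEg j k]]
        exact sum_bit_Bz n _ hgp (fun k => G k + (if k = j then 1 else 0) + 2 * H k) i (by omega)
      · unfold wt wSpike
        rw [if_pos (by omega), ← sum_ne n a ha.1 ha.2]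
        have hval : ∀ k : Fin n, (A + Finsupp.single j (2 ^ s) : Fin n →₀ ℕ) k / 2 ^ (s + L) % 2 =
            if ((k : ℕ) + 1 = a ∨ (k : ℕ) + 1 = b ∨ k = j) then 0 else 1 := by
          intro k
          rw [hEg, hlp, Nat.add_mul_div_left _ _ (by positivity),
            Nat.div_eq_of_lt (by rw [← hlp]; exact Bz_lt _ _)]
          simp only [hG, Fin.ext_iff]
          split_ifs <;> omega
        rw [Finset.sum_congr rfl fun k _ => hval k]
        apply Finset.sum_lt_sum
        · intro k _
          split_ifs <;> omega
        · refine ⟨jb, Finset.mem_univ _, ?_⟩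
          have : (jb : ℕ) + 1 = b := by simp [hjb]; omega
          rw [if_pos (Or.inr (Or.inl this)), if_neg (by omega)]
          norm_num
    rw [← add_assoc] at hm
    have h3 := (Submodule.add_mem_iff_left _ hrest).1 hm
    apply FF_eq_of_add
    unfold FF
    rw [← map_add]
    exact (Submodule.Quotient.mk_eq_zero _).2 h3
  · have := mdeg_EE n _ hg u hu1 hu2
    rw [← hE ⟨a - 1, by omega⟩ a b (by simp; omega) (Or.inl ⟨rfl, rfl⟩), mdeg_add, mdeg_single, hlen] at this
    exact this
  · intro i hi
    unfold wt wSpike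
    rw [if_pos (by omega)]
    exact sum_bit_Bz n p hp (fun k => (2 ^ L - 1) + 2 ^ L * (G k + 2 * H k)) i hi
  · intro j
    simp only [hA, ev_apply']
    rw [Nat.add_mul_div_left _ _ (by positivity), Nat.div_eq_of_lt (Bz_lt _ _)]
    obtain ⟨L, rfl⟩ := Nat.exists_eq_add_of_le' hL
    have h2 : 2 ^ (L + 1) * (G j + 2 * H j) = 2 * (2 ^ L * (G j + 2 * H j)) := by ring
    rw [h2, pow_succ]
    have := Nat.one_le_two_pow (n := L)
    omega

lemma FF_perm (n d u : ℕ) (hu1 : 1 ≤ u) (hu2 : u ≤ n) {l l' : List ℕ} (h : l.Perm l') :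
    ∀ p : List ℕ, (p ++ l).length = d → Good n (p ++ l) →
      FF n d u (p ++ l) = FF n d u (p ++ l') := by
  induction h with
  | nil => intros; rfl
  | cons x h ih =>
    intro p hl hg
    have := ih (p ++ [x]) (by simpa using hl) (by simpa using hg)
    simpa using this
  | swap x y l =>
    intro p hl hg
    by_cases hxy : y = x
    · rw [hxy]
    · exact block_rel n d u hu1 hu2 p l y x 1 le_rfl (by simpa using hl) (by simpa using hg) hxy
  | trans h1 h2 ih1 ih2 =>
    intro p hl hg
    rw [ih1 p hl hg]
    apply ih2 p
    · rw [← hl]; simp [h1.length_eq]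
    · intro x hx
      apply hg x
      simp only [List.mem_append] at hx ⊢
      rwa [h1.mem_iff]

lemma FF_dup (n d u : ℕ) (hu1 : 1 ≤ u) (hu2 : u ≤ n) (p l : List ℕ) (x y : ℕ) (hx : x ∈ l)
    (hy : y ∈ l) (hl : (p ++ x :: l).length = d) (hg : Good n (p ++ x :: l)) :
    FF n d u (p ++ x :: l) = FF n d u (p ++ y :: l) := by
  by_cases hxy : x = y
  · rw [hxy]
  have h1 := List.perm_cons_erase hx
  have h2 := List.perm_cons_erase ((List.mem_erase_of_ne (Ne.symm hxy)).2 hy)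
  set t := (l.erase x).erase y
  have h3 : l.Perm (x :: y :: t) := h1.trans (h2.cons x)
  have h4 : (x :: l).Perm (x :: x :: y :: t) := h3.cons x
  have h5 : (y :: l).Perm (y :: y :: x :: t) := (h3.trans (List.Perm.swap _ _ _)).cons y
  have hlen : (p ++ x :: l).length = (p ++ y :: l).length := by simp
  have hgy : Good n (p ++ y :: l) := by
    intro z hz
    apply hg z
    simp only [List.mem_append, List.mem_cons] at hz ⊢
    rcases hz with hz | rfl | hz
    · exact Or.inl hz
    · exact Or.inr (Or.inr hy)
    · exact Or.inr (Or.inr hz)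
  rw [FF_perm n d u hu1 hu2 h4 p hl hg, FF_perm n d u hu1 hu2 h5 p (hlen ▸ hl) hgy]
  refine block_rel n d u hu1 hu2 p t x y 2 (by norm_num) ?_ ?_ hxy
  · rw [← hl]; simp [h3.length_eq]
  · intro z hz
    apply hg z
    rw [List.mem_append] at hz ⊢
    rwa [h4.mem_iff]

lemma exists_dup {l : List ℕ} (h : ¬ l.Nodup) : ∃ x t, x ∈ t ∧ l.Perm (x :: t) := by
  obtain ⟨x, hx⟩ := List.exists_duplicate_iff_not_nodup.2 h
  refine ⟨x, l.erase x, ?_, List.perm_cons_erase hx.mem⟩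
  rw [List.duplicate_iff_two_le_count] at hx
  rw [← List.count_pos_iff, List.count_erase_self]
  omega

lemma nodup_iff_card (l : List ℕ) : l.Nodup ↔ l.toFinset.card = l.length := by
  refine ⟨List.toFinset_card_of_nodup, fun h => ?_⟩
  rw [List.card_toFinset] at h
  have := (List.dedup_sublist l).eq_of_length h
  exact List.dedup_eq_self.1 this

lemma FF_set (n d u : ℕ) (hu1 : 1 ≤ u) (hu2 : u ≤ n) (N : ℕ) : ∀ l l' : List ℕ,
    l.length = N → l'.length = N → l.toFinset = l'.toFinset →
    ∀ p : List ℕ, (p ++ l).length = d → Good n (p ++ l) →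
      FF n d u (p ++ l) = FF n d u (p ++ l') := by
  induction N with
  | zero =>
    intro l l' h1 h2 _ p _ _
    rw [List.length_eq_zero_iff] at h1 h2
    rw [h1, h2]
  | succ N ih =>
    intro l l' h1 h2 hset p hl hg
    by_cases hnd : l.Nodup
    · have hnd' : l'.Nodup := by
        rw [nodup_iff_card, ← hset, h2, ← h1]
        exact List.toFinset_card_of_nodup hnd
      exact FF_perm n d u hu1 hu2 (List.perm_of_nodup_nodup_toFinset_eq hnd hnd' hset) p hl hg
    · have hnd' : ¬ l'.Nodup := by
        intro hnd'
        apply hnd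
        rw [nodup_iff_card, hset, h1, ← h2]
        exact List.toFinset_card_of_nodup hnd'
      obtain ⟨x, t, hx, hp⟩ := exists_dup hnd
      obtain ⟨y, t', hy, hp'⟩ := exists_dup hnd'
      have e1 : l.toFinset = t.toFinset := by
        rw [List.toFinset_eq_of_perm _ _ hp, List.toFinset_cons, Finset.insert_eq_self]
        simpa using hx
      have e2 : l'.toFinset = t'.toFinset := by
        rw [List.toFinset_eq_of_perm _ _ hp', List.toFinset_cons, Finset.insert_eq_self]
        simpa using hy
      have e3 : t.toFinset = t'.toFinset := by rw [← e1, ← e2, hset]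
      have lt : t.length = N := by have := hp.length_eq; simp at this; omega
      have lt' : t'.length = N := by have := hp'.length_eq; simp at this; omega
      have hx' : x ∈ t' := by rw [← List.mem_toFinset, ← e3]; simpa using hx
      have hlen : p.length + (N + 1) = d := by rw [← hl]; simp [h1]
      have hgl : Good n l := (Good_append.1 hg).2
      have hgp : Good n p := (Good_append.1 hg).1
      have G1 : Good n (x :: t) := fun z hz => hgl z (hp.mem_iff.2 hz)
      have G2' : Good n t' := fun z hz => G1 z (by
        rw [← List.mem_toFinset, ← e3, List.mem_toFinset] at hz; simp [hz])
      have G2 : Good n (x :: t') := by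
        intro z hz
        rcases List.mem_cons.1 hz with rfl | hz
        · exact G1 _ (by simp)
        · exact G2' z hz
      have G3 : Good n l' := by
        intro z hz
        have := hp'.mem_iff.1 hz
        rcases List.mem_cons.1 this with rfl | hz
        · exact G2' _ hy
        · exact G2' z hz
      rw [FF_perm n d u hu1 hu2 hp p hl hg,
        FF_perm n d u hu1 hu2 hp' p (by simp [h2, hlen]) (Good_append.2 ⟨hgp, G3⟩),
        ← FF_dup n d u hu1 hu2 p t' x y hx' hy (by simp [lt', hlen]) (Good_append.2 ⟨hgp, G2⟩)]
      have := ih t t' lt lt' e3 (p ++ [x]) (by simp [lt]; omega) (by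
        rw [List.append_assoc]; exact Good_append.2 ⟨hgp, G1⟩)
      simpa using this

open Classical in
def KK (n d u : ℕ) (J : Finset ℕ) : P n ⧸ MM n d :=
  if h : ∃ l : List ℕ, l.length = d ∧ l.toFinset = J then FF n d u (Classical.choose h) else 0

lemma FF_eq_KK (n d u : ℕ) (hu1 : 1 ≤ u) (hu2 : u ≤ n) (l : List ℕ) (hl : l.length = d)
    (hg : Good n l) (J : Finset ℕ) (hJ : l.toFinset = J) : FF n d u l = KK n d u J := by
  have h : ∃ l : List ℕ, l.length = d ∧ l.toFinset = J := ⟨l, hl, hJ⟩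
  unfold KK
  rw [dif_pos h]
  obtain ⟨h1, h2⟩ := Classical.choose_spec h
  exact FF_set n d u hu1 hu2 d l _ hl h1 (by rw [h2, hJ]) [] (by simpa using hl) (by simpa using hg)

lemma exists_word (Q : Finset ℕ) (hne : Q.Nonempty) (N : ℕ) (hN : Q.card ≤ N) :
    ∃ l : List ℕ, l.length = N ∧ l.toFinset = Q := by
  obtain ⟨x, hx⟩ := hne
  refine ⟨Q.toList ++ List.replicate (N - Q.card) x, by simp; omega, ?_⟩
  ext z
  simp only [List.toFinset_append, Finset.toList_toFinset, Finset.mem_union, List.mem_toFinset,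
    List.mem_replicate]
  constructor
  · rintro (h | ⟨_, rfl⟩) <;> assumption
  · exact Or.inl

lemma top_KK (n d : ℕ) (hd1 : 2 ≤ d) (hd2 : d ≤ n) (Q : Finset ℕ) (hne : Q.Nonempty)
    (hQ : Q ⊆ Finset.Icc 1 (d - 1)) :
    ∑ u ∈ Finset.Icc 1 n, KK n d u (insert u Q) = 0 := by
  have hc := Finset.card_le_card hQ
  simp only [Nat.card_Icc] at hc
  obtain ⟨l, hl, hlQ⟩ := exists_word Q hne (d - 1) (by omega)
  have hg : Good n l := by
    intro x hx
    rw [← List.mem_toFinset, hlQ] at hx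
    have := Finset.mem_Icc.1 (hQ hx)
    omega
  rw [← top_rel n d l hg (by omega) (by omega)]
  refine Finset.sum_congr rfl fun u hu => ?_
  rw [Finset.mem_Icc] at hu
  refine (FF_eq_KK n d u hu.1 hu.2 _ (by simp; omega) (Good_append.2 ⟨hg, ?_⟩) _ ?_).symm
  · intro x hx; simp at hx; omega
  · simp only [List.toFinset_append, hlQ]
    ext; simp

lemma sum_powerset_Icc {V : Type*} [AddCommGroup V] (g : Finset ℕ → V) (m : ℕ) : ∀ t a : ℕ, a + t = m + 1 →
    ∑ Q ∈ (Finset.Icc a m).powerset, g Q =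
      g ∅ + ∑ i ∈ Finset.Icc a m, ∑ S ∈ (Finset.Icc (i + 1) m).powerset, g (insert i S) := by
  intro t
  induction t with
  | zero =>
    intro a ha
    rw [Finset.Icc_eq_empty (by omega)]
    simp
  | succ t ih =>
    intro a ha
    have h1 : Finset.Icc a m = insert a (Finset.Icc (a + 1) m) := by
      ext; simp; omega
    have h2 : a ∉ Finset.Icc (a + 1) m := by simp
    rw [h1, Finset.sum_powerset_insert h2, ih (a + 1) (by omega), Finset.sum_insert h2]
    abel

lemma final_sum (n d : ℕ) (hd1 : 2 ≤ d) (hd2 : d ≤ n) :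
    ∑ u ∈ Finset.Icc 1 (d - 1), KK n d u {u} +
      ∑ u ∈ Finset.Icc d n, ∑ i ∈ Finset.Icc 1 (d - 1),
        ∑ S ∈ (Finset.Icc (i + 1) (d - 1)).powerset, KK n d u (insert u (insert i S)) = 0 := by
  have h1 : ∑ u ∈ Finset.Icc 1 n, ∑ i ∈ Finset.Icc 1 (d - 1),
        ∑ S ∈ (Finset.Icc (i + 1) (d - 1)).powerset, KK n d u (insert u (insert i S)) = 0 := by
    rw [Finset.sum_comm]
    refine Finset.sum_eq_zero fun i hi => ?_
    rw [Finset.sum_comm]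
    refine Finset.sum_eq_zero fun S hS => ?_
    apply top_KK n d hd1 hd2 _ (Finset.insert_nonempty _ _)
    rw [Finset.insert_subset_iff]
    refine ⟨hi, (Finset.mem_powerset.1 hS).trans (Finset.Icc_subset_Icc_left (by omega))⟩
  have hu : Finset.Icc 1 n = Finset.Icc 1 (d - 1) ∪ Finset.Icc d n := by
    ext; simp; omega
  have hdj : Disjoint (Finset.Icc 1 (d - 1)) (Finset.Icc d n) := by
    rw [Finset.disjoint_left]; intro x; simp; omega
  rw [hu, Finset.sum_union hdj] at h1
  rw [← h1]
  congr 1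
  refine Finset.sum_congr rfl fun u hu => ?_
  apply FF_eq_of_add
  have h2 := sum_powerset_Icc (fun Q => KK n d u (insert u Q)) (d - 1) (d - 1) 1 (by omega)
  simp only [insert_empty_eq] at h2
  rw [← h2]
  have h3 : Finset.Icc 1 (d - 1) = insert u ((Finset.Icc 1 (d - 1)).erase u) :=
    (Finset.insert_erase hu).symm
  rw [h3, Finset.sum_powerset_insert (by simp)]
  simp only [Finset.insert_idem]
  exact FF_char2 _

def Zr (I : List ℕ) (k : ℕ) : ℕ :=
  ∑ t ∈ Finset.range I.length, if I.getD t 0 = k + 1 then 2 ^ (I.length - 1 - t) else 0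

lemma Zr_cons (a : ℕ) (I : List ℕ) (k : ℕ) :
    Zr (a :: I) k = Zr I k + (if a = k + 1 then 2 ^ I.length else 0) := by
  unfold Zr
  rw [List.length_cons, Finset.sum_range_succ']
  congr 1
  refine Finset.sum_congr rfl fun t ht => ?_
  rw [List.getD_cons_succ]
  congr 2
  omega

lemma Zr_Bz (I : List ℕ) (k : ℕ) : Bz I.reverse k + Zr I k = 2 ^ I.length - 1 := by
  induction I with
  | nil => simp [Bz, Zr]
  | cons a I ih =>
    rw [List.reverse_cons, Bz_append, Zr_cons, List.length_reverse, List.length_cons, pow_succ]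
    simp only [Bz]
    have := Nat.one_le_two_pow (n := I.length)
    split_ifs <;> omega

lemma Zr_zero (I : List ℕ) (k : ℕ) (h : k + 1 ∉ I) : Zr I k = 0 := by
  induction I with
  | nil => simp [Zr]
  | cons a I ih =>
    simp only [List.mem_cons, not_or] at h
    rw [Zr_cons, ih h.2, if_neg (Ne.symm h.1)]

lemma xIu_Zr (n : ℕ) (I : List ℕ) (hI : I ≠ []) (k : Fin n) : xIuExp n I 1 k = Zr I k := by
  obtain ⟨a, I, rfl⟩ := List.exists_cons_of_ne_nil hI
  rw [Zr_cons]
  unfold xIuExp Zr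
  rw [add_comm]
  congr 1
  · rw [← Finset.Ico_add_one_right_eq_Icc, Finset.sum_Ico_eq_sum_range]
    simp only [List.length_cons]
    refine Finset.sum_congr (by congr 1) fun t ht => ?_
    have e : 1 + 1 + t - 1 = t + 1 := by omega
    rw [e, List.getD_cons_succ]
    congr 2
    omega
  · simp only [List.length_cons, Nat.sub_self, List.getD_cons_zero]
    congr 1
    rw [Nat.add_sub_cancel, pow_succ]; omega

lemma nuE_Xexp (m e k : ℕ) (h : k - 1 < m) : nuE (Xexp m e) k = e := by
  unfold nuE
  rw [dif_pos h]; rfl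

lemma mapDomain_fIdx (n i e : ℕ) (hi : 1 ≤ i) (hin : i ≤ n) (k : Fin n) :
    Finsupp.mapDomain (fIdx n i) (Xexp (n - 1) e) k = if (k : ℕ) + 1 = i then 0 else e := by
  have hval : ∀ j : Fin (n - 1), ((fIdx n i j : Fin n) : ℕ) = if (j : ℕ) + 1 < i then (j : ℕ) else j + 1 := by
    intro j; unfold fIdx; split_ifs <;> rfl
  have hinj : Function.Injective (fIdx n i) := by
    intro x y h
    have := congrArg Fin.val h
    rw [hval, hval] at this
    ext
    split_ifs at this <;> omega
  split_ifs with hk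
  · apply Finsupp.mapDomain_of_notMem_range
    rintro ⟨j, hj⟩
    have := congrArg Fin.val hj
    rw [hval] at this
    split_ifs at this <;> omega
  · have : ∃ j, fIdx n i j = k := by
      by_cases h : (k : ℕ) + 1 < i
      · refine ⟨⟨k, by omega⟩, ?_⟩
        ext; rw [hval]; simp only; rw [if_pos h]
      · refine ⟨⟨k - 1, by have := k.isLt; omega⟩, ?_⟩
        ext; rw [hval]; simp only; rw [if_neg (by omega)]; omega
    obtain ⟨j, rfl⟩ := this
    rw [Finsupp.mapDomain_apply hinj]; rfl

lemma phi_eq (n d i u : ℕ) (I : List ℕ) (hI : ∀ x ∈ I, 2 ≤ x ∧ x ≤ n) (hi : 1 ≤ i) (hin : i ≤ n)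
    (hiI : i ∉ I) (hne : I ≠ []) (hr : I.length < d) :
    phiMon n i I (Xexp (n - 1) (2 ^ d - 1)) * xvMon n u (2 ^ d) =
      monomial (EE n (I.reverse ++ List.replicate (d - I.length) i) u) 1 := by
  have hnu : ∀ t, 1 ≤ t → t ≤ I.length →
      nuE (Xexp (n - 1) (2 ^ d - 1)) (I.getD (t - 1) 0 - 1) = 2 ^ d - 1 := by
    intro t h1 h2
    apply nuE_Xexp
    have hlt : t - 1 < I.length := by omega
    rw [List.getD_eq_getElem _ _ hlt]
    have := hI _ (List.getElem_mem hlt)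
    omega
  have hpos : 0 < I.length := List.length_pos_iff.2 hne
  have hpow : 2 ^ I.length < 2 ^ d := Nat.pow_lt_pow_right (by norm_num) hr
  have hpow1 := Nat.one_le_two_pow (n := I.length)
  have hc : uCompat I 1 (Xexp (n - 1) (2 ^ d - 1)) := by
    unfold uCompat
    rw [if_neg hne]
    refine ⟨le_rfl, hpos, fun t h1 h2 => by omega, ?_, ?_, ?_⟩
    · rw [hnu 1 le_rfl hpos]; omega
    · intro t h1 h2
      rw [hnu 1 le_rfl hpos, Nat.testBit_two_pow_sub_one]
      simp; omega
    · intro t h1 h2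
      rw [hnu t (by omega) h2, Nat.testBit_two_pow_sub_one]
      simp; omega
  have huniq : ∀ v, uCompat I v (Xexp (n - 1) (2 ^ d - 1)) → v = 1 := by
    intro v hv
    unfold uCompat at hv
    rw [if_neg hne] at hv
    obtain ⟨h1, h2, h3, -⟩ := hv
    by_contra hcon
    have := h3 1 le_rfl (by omega)
    rw [hnu 1 le_rfl hpos] at this
    omega
  have hex : ∃ v, uCompat I v (Xexp (n - 1) (2 ^ d - 1)) := ⟨1, hc⟩
  unfold phiMon
  rw [dif_pos hex, huniq _ (Classical.choose_spec hex)]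
  unfold xvMon
  rw [monomial_mul, mul_one]
  refine congrArg (fun e => monomial e (1 : ZMod 2)) ?_
  ext k
  simp only [Finsupp.add_apply, ev_apply', EE]
  rw [xIu_Zr n I hne, mapDomain_fIdx n i _ hi hin, Bz_append, Bz_replicate]
  have hZ := Zr_Bz I k
  have hlen : (I.reverse ++ List.replicate (d - I.length) i).length = d := by simp; omega
  rw [hlen, List.length_reverse]
  have hdd : 2 ^ I.length * (2 ^ (d - I.length) - 1) = 2 ^ d - 2 ^ I.length := by
    rw [Nat.mul_sub, ← pow_add, mul_one]; congr 2; omega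
  by_cases hk : (k : ℕ) + 1 = i
  · have := Zr_zero I k (by rw [hk]; exact hiI)
    rw [if_pos hk, if_pos hk, if_pos hk.symm]
    split_ifs <;> omega
  · rw [if_neg hk, if_neg hk, if_neg (Ne.symm hk), hdd]
    split_ifs <;> omega

lemma first_eq (n d u : ℕ) : XjMon n u (2 ^ d - 1) * xvMon n u (2 ^ d) =
    monomial (EE n (List.replicate d u) u) 1 := by
  unfold XjMon xvMon
  rw [monomial_mul, mul_one]
  refine congrArg (fun e => monomial e (1 : ZMod 2)) ?_
  ext k
  simp only [Finsupp.add_apply, ev_apply', EE, Bz_replicate, List.length_replicate]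
  split_ifs <;> omega

/-- Corollary 3.9: for `2 ≤ d ≤ n`,
`Σ_{u=1}^{d−1} X_u^{2^d−1} x_u^{2^d}
+ Σ_{u=d}^{n} Σ_{(i;I)∈N_{d−1}} φ_{(i;I∪u)}(X^{2^d−1}) x_u^{2^d} ∈ A_d^+P_n + P_n^−(ω)`
with `ω = ((n−1)^{(d)}, 1)`.  A pair `(i;I) ∈ N_{d−1}` is encoded as `1 ≤ i ≤ d−1`
together with a finite set `S ⊆ {i+1, …, d−1}`. -/
theorem statement10 (n d : ℕ) (hd1 : 2 ≤ d) (hd2 : d ≤ n) :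
    (∑ u ∈ Finset.Icc 1 (d - 1), XjMon n u (2 ^ d - 1) * xvMon n u (2 ^ d))
    + (∑ u ∈ Finset.Icc d n, ∑ i ∈ Finset.Icc 1 (d - 1),
        ∑ S ∈ (Finset.Icc (i + 1) (d - 1)).powerset,
          phiMon n i ((insert u S).sort (· ≤ ·)) (Xexp (n - 1) (2 ^ d - 1))
            * xvMon n u (2 ^ d))
    ∈ AplusS n d ⊔ PnLt n ((n - 1) * (2 ^ d - 1) + 2 ^ d) (wSpike n d) := by
  rw [← Submodule.Quotient.mk_eq_zero (MM n d), ← Submodule.mkQ_apply, map_add, map_sum, map_sum,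
    ← final_sum n d hd1 hd2]
  congr 1
  · refine Finset.sum_congr rfl fun u hu => ?_
    rw [Finset.mem_Icc] at hu
    rw [first_eq]
    refine FF_eq_KK n d u (by omega) (by omega) _ (by simp) (Good_replicate (by omega)) _ ?_
    ext; simp; omega
  · refine Finset.sum_congr rfl fun u hu => ?_
    rw [map_sum]
    refine Finset.sum_congr rfl fun i hi => ?_
    rw [map_sum]
    refine Finset.sum_congr rfl fun S hS => ?_
    rw [Finset.mem_Icc] at hu hi
    rw [Finset.mem_powerset] at hS
    have hS' : ∀ x ∈ S, i + 1 ≤ x ∧ x ≤ d - 1 := fun x hx => Finset.mem_Icc.1 (hS hx)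
    have huS : u ∉ S := fun h => by have := hS' u h; omega
    have hcard : S.card ≤ d - 1 - i := by
      have := Finset.card_le_card hS
      simp only [Nat.card_Icc] at this
      omega
    have hlen : ((insert u S).sort (· ≤ ·)).length = S.card + 1 := by
      rw [Finset.length_sort, Finset.card_insert_of_notMem huS]
    have hmem : ∀ x, x ∈ (insert u S).sort (· ≤ ·) ↔ x = u ∨ x ∈ S := by
      intro x; rw [Finset.mem_sort, Finset.mem_insert]
    have hb : ∀ x ∈ (insert u S).sort (· ≤ ·), i < x ∧ x ≤ n := by
      intro x hx
      rcases (hmem x).1 hx with rfl | hx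
      · omega
      · have := hS' x hx; omega
    rw [phi_eq n d i u _ (fun x hx => by have := hb x hx; omega) (by omega) (by omega)
      (fun h => by have := hb i h; omega) (by intro h; rw [h] at hlen; simp at hlen) (by omega)]
    refine FF_eq_KK n d u (by omega) (by omega) _ ?_ ?_ _ ?_
    · rw [List.length_append, List.length_reverse, List.length_replicate]; omega
    · refine Good_append.2 ⟨fun x hx => ?_, Good_replicate (by omega)⟩
      have := hb x (List.mem_reverse.1 hx)
      omega
    · ext x
      have hpos : d - ((insert u S).sort (· ≤ ·)).length ≠ 0 := by omega
      simp only [List.mem_toFinset, List.mem_append, List.mem_reverse, hmem, List.mem_replicate,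
        Finset.mem_insert]
      tauto
end
end
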